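/- arXiv:2601.09329 — 9 statements merged into one kernel-verified Lean document; each statement's English description precedes it below -/
import Mathlib

section
/- Let n, m ≥ 1, let u₁, …, u_m ∈ ℂⁿ, let U be the n×m complex matrix with columns u₁, …, u_m, let A = I_m + U*U (where U* is the conjugate transpose), and for 1 ≤ i, j ≤ m let M_{ij} denote the (i,j)-minor of A, i.e. the determinant of the (m−1)×(m−1) matrix obtained from A by deleting row i and column j. Then I_n + UU* is invertible, and for all 1 ≤ i, j ≤ m: if i = j then u_i*(I_n + UU*)⁻¹u_i = 1 − M_{ii}/det(A), and if i ≠ j then u_i*(I_n + UU*)⁻¹u_j = (−1)^{i+j+1} M_{ji}/det(A). -/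
open Matrix

open scoped ComplexOrder in
theorem isUnit_one_add_conjTranspose_mul_self {k l : Type*} [Fintype k] [Fintype l]
    [DecidableEq l] (U : Matrix k l ℂ) : IsUnit (1 + Uᴴ * U) :=
  (PosDef.one.add_posSemidef (posSemidef_conjTranspose_mul_self U)).isUnit

/-- The push-through identity in the form `Uᴴ (1 + U Uᴴ)⁻¹ U = 1 - (1 + Uᴴ U)⁻¹`. -/
theorem conjTranspose_mul_inv_one_add_mul {k l : Type*} [Fintype k] [Fintype l]
    [DecidableEq k] [DecidableEq l] (U : Matrix k l ℂ) :
    Uᴴ * (1 + U * Uᴴ)⁻¹ * U = 1 - (1 + Uᴴ * U)⁻¹ := by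
  have hA : IsUnit (1 + Uᴴ * U).det :=
    (isUnit_iff_isUnit_det _).1 (isUnit_one_add_conjTranspose_mul_self U)
  have hB : IsUnit (1 + U * Uᴴ).det := by
    rwa [det_one_add_mul_comm]
  have hcomm : (1 + Uᴴ * U) * Uᴴ = Uᴴ * (1 + U * Uᴴ) := by
    rw [Matrix.add_mul, Matrix.mul_add, Matrix.mul_assoc, Matrix.one_mul, Matrix.mul_one]
  have hpush : Uᴴ * (1 + U * Uᴴ)⁻¹ = (1 + Uᴴ * U)⁻¹ * Uᴴ := by
    rw [← nonsing_inv_mul_cancel_left _ (Uᴴ * (1 + U * Uᴴ)⁻¹) hA, ← Matrix.mul_assoc _ Uᴴ,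
      hcomm, mul_nonsing_inv_cancel_right _ _ hB]
  rw [hpush, Matrix.mul_assoc, eq_sub_iff_add_eq]
  nth_rewrite 2 [← Matrix.mul_one (1 + Uᴴ * U)⁻¹]
  rw [← Matrix.mul_add, add_comm (Uᴴ * U), nonsing_inv_mul _ hA]

theorem inv_apply_eq_det_submatrix_div {K : Type*} [Field K] {m : ℕ}
    (A : Matrix (Fin (m + 1)) (Fin (m + 1)) K) (i j : Fin (m + 1)) :
    A⁻¹ i j = (-1) ^ (i.val + j.val) * (A.submatrix j.succAbove i.succAbove).det / A.det := by
  rw [inv_def, Matrix.smul_apply, adjugate_fin_succ_eq_det_submatrix, Ring.inverse_eq_inv', smul_eq_mul,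
    add_comm j.val]
  ring

/-- Lemma 1. For `u₁,…,u_m ∈ ℂⁿ` (here `m = m' + 1 ≥ 1`), with
`U` the matrix with columns `u i`, `A = I_m + Uᴴ U`, the matrix `I_n + U Uᴴ`
is invertible and the quadratic forms `uᵢᴴ (I_n + U Uᴴ)⁻¹ uⱼ` are expressed
via minors of `A`. Indices here are 0-based; the (i,j)-minor is the
determinant of `A` with row `i` and column `j` deleted, and the sign
`(-1)^(i+j+1)` matches the 1-based formula since parities agree. -/
theorem stmt0 (n m' : ℕ) (hn : 1 ≤ n) (u : Fin (m' + 1) → Fin n → ℂ) :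
    let U : Matrix (Fin n) (Fin (m' + 1)) ℂ := Matrix.of fun k i => u i k
    let A : Matrix (Fin (m' + 1)) (Fin (m' + 1)) ℂ := 1 + Uᴴ * U
    let B : Matrix (Fin n) (Fin n) ℂ := 1 + U * Uᴴ
    IsUnit B ∧
      ∀ i j : Fin (m' + 1),
        (i = j →
          star (u i) ⬝ᵥ B⁻¹ *ᵥ u i =
            1 - (A.submatrix i.succAbove i.succAbove).det / A.det) ∧
        (i ≠ j →
          star (u i) ⬝ᵥ B⁻¹ *ᵥ u j =
            (-1 : ℂ) ^ (i.val + j.val + 1) *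
              (A.submatrix j.succAbove i.succAbove).det / A.det) := by
  intro U A B
  have hentry (i j : Fin (m' + 1)) :
      star (u i) ⬝ᵥ B⁻¹ *ᵥ u j = (1 : Matrix _ _ ℂ) i j -
        (-1) ^ (i.val + j.val) * (A.submatrix j.succAbove i.succAbove).det / A.det := by
    rw [← inv_apply_eq_det_submatrix_div, ← Matrix.sub_apply,
      ← conjTranspose_mul_inv_one_add_mul U, Matrix.mul_assoc]
    rfl
  refine ⟨by simpa using isUnit_one_add_conjTranspose_mul_self Uᴴ,
    fun i j => ⟨fun _ => ?_, fun hij => ?_⟩⟩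
  · rw [hentry, one_apply_eq, Even.neg_one_pow ⟨_, rfl⟩, one_mul]
  · rw [hentry, one_apply_ne hij]
    ring
end

section
/- Let n ≥ 1, let D₁, D₂ ∈ ℝⁿ be column vectors, and let D = [D₁ D₂] be the n×2 real matrix with columns D₁ and D₂. Then I_n + D₁D₁ᵀ + D₂D₂ᵀ is invertible, det(I₂ + DᵀD) ≠ 0, and 1 − D₁ᵀ(I_n + D₁D₁ᵀ + D₂D₂ᵀ)⁻¹D₁ = (1 + D₂ᵀD₂)/det(I₂ + DᵀD). -/
open Matrix

/-- For column vectors `D₁, D₂ ∈ ℝⁿ` (`n ≥ 1`) and `D = [D₁ D₂]`,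
the matrix `I_n + D₁D₁ᵀ + D₂D₂ᵀ` is invertible, `det(I₂ + DᵀD) ≠ 0`, and
`1 − D₁ᵀ(I_n + D₁D₁ᵀ + D₂D₂ᵀ)⁻¹D₁ = (1 + D₂ᵀD₂)/det(I₂ + DᵀD)`. -/
theorem stmt3 (n : ℕ) (hn : 1 ≤ n) (D₁ D₂ : Fin n → ℝ) :
    let D : Matrix (Fin n) (Fin 2) ℝ := Matrix.of fun k i => ![D₁ k, D₂ k] i
    let B : Matrix (Fin n) (Fin n) ℝ := 1 + vecMulVec D₁ D₁ + vecMulVec D₂ D₂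
    IsUnit B ∧
    ((1 : Matrix (Fin 2) (Fin 2) ℝ) + Dᵀ * D).det ≠ 0 ∧
    1 - D₁ ⬝ᵥ B⁻¹ *ᵥ D₁ =
      (1 + D₂ ⬝ᵥ D₂) / ((1 : Matrix (Fin 2) (Fin 2) ℝ) + Dᵀ * D).det := by
  intro D B
  have hdet : ((1 : Matrix (Fin 2) (Fin 2) ℝ) + Dᵀ * D).det =
      (1 + D₁ ⬝ᵥ D₁) * (1 + D₂ ⬝ᵥ D₂) - (D₁ ⬝ᵥ D₂) ^ 2 := by
    have h21 : ∑ k, D₂ k * D₁ k = ∑ k, D₁ k * D₂ k := by simp only [mul_comm]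
    simp [D, det_fin_two, mul_apply, dotProduct, h21]
    ring
  have hB : B = 1 + D * Dᵀ := by
    ext i j
    simp [B, D, mul_apply, vecMulVec_apply, add_assoc]
  have hpos : 0 < ((1 : Matrix (Fin 2) (Fin 2) ℝ) + Dᵀ * D).det := by
    have hcs : (D₁ ⬝ᵥ D₂) ^ 2 ≤ (D₁ ⬝ᵥ D₁) * (D₂ ⬝ᵥ D₂) := by
      simpa [dotProduct, sq] using Finset.sum_mul_sq_le_sq_mul_sq Finset.univ D₁ D₂
    have h₁ : 0 ≤ D₁ ⬝ᵥ D₁ := Finset.sum_nonneg fun k _ => mul_self_nonneg (D₁ k)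
    have h₂ : 0 ≤ D₂ ⬝ᵥ D₂ := Finset.sum_nonneg fun k _ => mul_self_nonneg (D₂ k)
    rw [hdet]
    nlinarith
  have hBdet : IsUnit B.det := by
    rw [hB, det_one_add_mul_comm]
    exact hpos.ne'.isUnit
  refine ⟨(isUnit_iff_isUnit_det B).2 hBdet, hpos.ne', ?_⟩
  have hx : B *ᵥ (B⁻¹ *ᵥ D₁) = D₁ := by
    rw [mulVec_mulVec, mul_nonsing_inv B hBdet, one_mulVec]
  rw [eq_div_iff hpos.ne', hdet]
  generalize B⁻¹ *ᵥ D₁ = x at hx ⊢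
  have expand (v : Fin n → ℝ) :
      v ⬝ᵥ x + (D₁ ⬝ᵥ x) * (v ⬝ᵥ D₁) + (D₂ ⬝ᵥ x) * (v ⬝ᵥ D₂) = v ⬝ᵥ D₁ := by
    conv_rhs => rw [← hx]
    simp [B, add_mulVec, vecMulVec_mulVec, dotProduct_add, dotProduct_smul]
  have h₁ := expand D₁
  have h₂ := expand D₂
  rw [dotProduct_comm D₂ D₁] at h₂
  linear_combination (-(1 + D₂ ⬝ᵥ D₂)) * h₁ + (D₁ ⬝ᵥ D₂) * h₂
end

section
/- Let n ≥ 1, let D₁, D₂ ∈ ℝⁿ be column vectors, let D = [D₁ D₂] be the n×2 real matrix with columns D₁ and D₂, and let a, b ∈ ℝ with v = (a, b)ᵀ ∈ ℝ². Then vᵀ(I₂ − Dᵀ(I_n + DDᵀ)⁻¹D)v = (a² + b² + ‖aD₂ − bD₁‖²)/det(I₂ + DᵀD), where ‖·‖ is the Euclidean norm on ℝⁿ. -/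
open Matrix

theorem Matrix.isUnit_one_add_mul_transpose {m n : Type*} [Fintype m] [Fintype n] [DecidableEq m]
    (D : Matrix m n ℝ) : IsUnit (1 + D * Dᵀ) := by
  have h := PosDef.one.add_posSemidef (posSemidef_self_mul_conjTranspose D)
  rw [conjTranspose_eq_transpose_of_trivial] at h
  exact h.isUnit

theorem Matrix.one_sub_transpose_mul_inv_mul {m n : Type*} [Fintype m] [Fintype n]
    [DecidableEq m] [DecidableEq n] (D : Matrix m n ℝ) :
    1 - Dᵀ * (1 + D * Dᵀ)⁻¹ * D = (1 + Dᵀ * D)⁻¹ := by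
  have h := add_mul_mul_inv_eq_sub 1 Dᵀ 1 D isUnit_one isUnit_one
    (by simpa using isUnit_one_add_mul_transpose D)
  simpa using h.symm

theorem Matrix.dotProduct_inv_mulVec_fin_two {K : Type*} [Field K]
    (A : Matrix (Fin 2) (Fin 2) K) (a b : K) :
    ![a, b] ⬝ᵥ A⁻¹ *ᵥ ![a, b] =
      (a ^ 2 * A 1 1 - a * b * (A 0 1 + A 1 0) + b ^ 2 * A 0 0) / A.det := by
  rw [inv_def, adjugate_fin_two, Ring.inverse_eq_inv', smul_mulVec, dotProduct_smul]
  simp only [dotProduct, mulVec, Fin.sum_univ_two, of_apply, cons_val', cons_val_zero,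
    cons_val_one, cons_val_fin_one, smul_eq_mul]
  ring

/-- For `D₁, D₂ ∈ ℝⁿ` (`n ≥ 1`), `D = [D₁ D₂]`, `v = (a, b)ᵀ`:
`vᵀ(I₂ − Dᵀ(I_n + DDᵀ)⁻¹D)v = (a² + b² + ‖aD₂ − bD₁‖²)/det(I₂ + DᵀD)`,
where `‖u‖² = ∑ k, u k ^ 2` is the squared Euclidean norm. -/
theorem stmt4 (n : ℕ) (hn : 1 ≤ n) (D₁ D₂ : Fin n → ℝ) (a b : ℝ) :
    let D : Matrix (Fin n) (Fin 2) ℝ := Matrix.of fun k i => ![D₁ k, D₂ k] i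
    let v : Fin 2 → ℝ := ![a, b]
    v ⬝ᵥ ((1 : Matrix (Fin 2) (Fin 2) ℝ)
        - Dᵀ * ((1 : Matrix (Fin n) (Fin n) ℝ) + D * Dᵀ)⁻¹ * D) *ᵥ v =
      (a ^ 2 + b ^ 2 + ∑ k, (a * D₂ k - b * D₁ k) ^ 2) /
        ((1 : Matrix (Fin 2) (Fin 2) ℝ) + Dᵀ * D).det := by
  intro D v
  rw [one_sub_transpose_mul_inv_mul, dotProduct_inv_mulVec_fin_two]
  congr 1
  simp only [D, Matrix.add_apply, mul_apply, transpose_apply, of_apply, one_apply_eq, ne_eq,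
    zero_ne_one, one_ne_zero, not_false_eq_true, one_apply_ne, cons_val_zero, cons_val_one,
    zero_add, mul_add, mul_one, Finset.mul_sum]
  have h : ∑ k, (a * D₂ k - b * D₁ k) ^ 2 = ∑ k, a ^ 2 * (D₂ k * D₂ k)
      - (∑ k, a * b * (D₁ k * D₂ k) + ∑ k, a * b * (D₂ k * D₁ k))
      + ∑ k, b ^ 2 * (D₁ k * D₁ k) := by
    simp only [← Finset.sum_add_distrib, ← Finset.sum_sub_distrib]
    exact Finset.sum_congr rfl fun k _ => by ring
  rw [h]
  ring
end

section
/- For every n ≥ 1, (∑_{k=1}^n d₁ₖ²)(∑_{k=1}^n d₂ₖ²) − (∑_{k=1}^n d₁ₖd₂ₖ)² = ∑_{1 ≤ i < j ≤ n} (d₁ᵢd₂ⱼ − d₁ⱼd₂ᵢ)² = (γ₁ − γ₂)² c₁² c₂² γ₁² γ₂² ℓ₁² ℓ₂² · [ (γ₁^{2n} − 1)(γ₂^{2n} − 1)/((γ₁² − 1)(γ₂² − 1)) − ((γ₁γ₂)ⁿ − 1)²/((γ₁γ₂ − 1)²) ]. -/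
/-- **Lagrange's identity** for sums over `1, …, n`. -/
theorem sum_sq_mul_sum_sq_sub_sq_sum_mul {R : Type*} [CommRing R] (f g : ℕ → R) (n : ℕ) :
    (∑ k ∈ Finset.Icc 1 n, f k ^ 2) * (∑ k ∈ Finset.Icc 1 n, g k ^ 2)
        - (∑ k ∈ Finset.Icc 1 n, f k * g k) ^ 2 =
      ∑ i ∈ Finset.Icc 1 n, ∑ j ∈ Finset.Ioc i n, (f i * g j - f j * g i) ^ 2 := by
  induction n with
  | zero => simp
  | succ n ih =>
    have inner : ∀ i ∈ Finset.Icc 1 n,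
        ∑ j ∈ Finset.Ioc i (n + 1), (f i * g j - f j * g i) ^ 2 =
          ∑ j ∈ Finset.Ioc i n, (f i * g j - f j * g i) ^ 2 +
            (f i ^ 2 * g (n + 1) ^ 2 - f i * g i * (2 * f (n + 1) * g (n + 1)) +
              g i ^ 2 * f (n + 1) ^ 2) := by
      intro i hi
      rw [Finset.sum_Ioc_succ_top (Finset.mem_Icc.mp hi).2]
      ring
    simp only [Finset.sum_Icc_succ_top (Nat.le_add_left 1 n)]
    rw [Finset.sum_congr rfl inner, Finset.Ioc_self, Finset.sum_empty, Finset.sum_add_distrib,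
      ← ih, Finset.sum_add_distrib, Finset.sum_sub_distrib, ← Finset.sum_mul, ← Finset.sum_mul,
      ← Finset.sum_mul]
    ring

/-- The geometric sum `x + x² + ⋯ + xⁿ`. -/
theorem sum_Icc_one_pow {K : Type*} [Field K] {x : K} (hx : x ≠ 1) (n : ℕ) :
    ∑ k ∈ Finset.Icc 1 n, x ^ k = x * ((x ^ n - 1) / (x - 1)) := by
  have hx' : x - 1 ≠ 0 := sub_ne_zero.mpr hx
  induction n with
  | zero => simp
  | succ n ih =>
    rw [Finset.sum_Icc_succ_top (Nat.le_add_left 1 n), ih]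
    field_simp
    ring


/-- Cauchy–Binet style identity (equation (25) of the paper).
With `γ₁ ≠ γ₂`, `|γ₁|, |γ₂| > 1`, `ℓ₁, ℓ₂ ≠ 0`, and the coefficients
`d₁ₖ, d₂ₖ` of the SK(2) scheme, for every `n ≥ 1`:
`(∑ d₁ₖ²)(∑ d₂ₖ²) − (∑ d₁ₖ d₂ₖ)² = ∑_{i<j} (d₁ᵢd₂ⱼ − d₁ⱼd₂ᵢ)²`, and this
equals the stated closed form. -/
theorem stmt5 (γ₁ γ₂ ℓ₁ ℓ₂ : ℝ) (h12 : γ₁ ≠ γ₂) (h1 : 1 < |γ₁|) (h2 : 1 < |γ₂|)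
    (hl1 : ℓ₁ ≠ 0) (hl2 : ℓ₂ ≠ 0) (n : ℕ) (hn : 1 ≤ n) :
    let c₁ : ℝ := 1 / (γ₁ * (γ₁ - γ₂))
    let c₂ : ℝ := 1 / (γ₂ * (γ₂ - γ₁))
    let d₁ : ℕ → ℝ := fun k => -(c₁ * γ₂ * ℓ₁ * γ₁ ^ k + c₂ * γ₁ * ℓ₂ * γ₂ ^ k)
    let d₂ : ℕ → ℝ := fun k => c₁ * ℓ₁ * γ₁ ^ k + c₂ * ℓ₂ * γ₂ ^ k
    ((∑ k ∈ Finset.Icc 1 n, (d₁ k) ^ 2) * (∑ k ∈ Finset.Icc 1 n, (d₂ k) ^ 2)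
        - (∑ k ∈ Finset.Icc 1 n, d₁ k * d₂ k) ^ 2 =
      ∑ i ∈ Finset.Icc 1 n, ∑ j ∈ Finset.Ioc i n,
        (d₁ i * d₂ j - d₁ j * d₂ i) ^ 2) ∧
    (∑ i ∈ Finset.Icc 1 n, ∑ j ∈ Finset.Ioc i n,
        (d₁ i * d₂ j - d₁ j * d₂ i) ^ 2 =
      (γ₁ - γ₂) ^ 2 * c₁ ^ 2 * c₂ ^ 2 * γ₁ ^ 2 * γ₂ ^ 2 * ℓ₁ ^ 2 * ℓ₂ ^ 2 *
        ((γ₁ ^ (2 * n) - 1) * (γ₂ ^ (2 * n) - 1) /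
            ((γ₁ ^ 2 - 1) * (γ₂ ^ 2 - 1))
          - ((γ₁ * γ₂) ^ n - 1) ^ 2 / (γ₁ * γ₂ - 1) ^ 2)) := by
  intro c₁ c₂ d₁ d₂
  refine ⟨sum_sq_mul_sum_sq_sub_sq_sum_mul d₁ d₂ n, ?_⟩
  have hγ₁ : γ₁ ^ 2 ≠ 1 := ((one_lt_sq_iff_one_lt_abs γ₁).mpr h1).ne'
  have hγ₂ : γ₂ ^ 2 ≠ 1 := ((one_lt_sq_iff_one_lt_abs γ₂).mpr h2).ne'
  have hγ : γ₁ * γ₂ ≠ 1 := by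
    intro h
    have habs : |γ₁| * |γ₂| = 1 := by rw [← abs_mul, h, abs_one]
    exact (one_lt_mul_of_lt_of_le h1 h2.le).ne' habs
  have minor : ∀ i j, (d₁ i * d₂ j - d₁ j * d₂ i) ^ 2 =
      (γ₁ - γ₂) ^ 2 * c₁ ^ 2 * c₂ ^ 2 * ℓ₁ ^ 2 * ℓ₂ ^ 2 *
        (γ₁ ^ i * γ₂ ^ j - γ₁ ^ j * γ₂ ^ i) ^ 2 := by
    intro i j
    simp only [d₁, d₂]
    ring
  simp only [minor, ← Finset.mul_sum]
  rw [← sum_sq_mul_sum_sq_sub_sq_sum_mul (fun k => γ₁ ^ k) (fun k => γ₂ ^ k) n]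
  simp only [← mul_pow, pow_right_comm _ _ 2]
  rw [sum_Icc_one_pow hγ₁, sum_Icc_one_pow hγ₂, sum_Icc_one_pow hγ, pow_mul, pow_mul,
    mul_div_mul_comm, ← div_pow]
  ring
end

section
/- The sequence det(I₂ + DₙᵀDₙ)/(γ₁γ₂)^{2n} converges to Δγ₁²γ₂² as n → ∞. -/
open Matrix Filter

/-- A geometric sum of ratio `q` with `1 < |q|`, normalized by `q ^ n`, tends to `q / (q - 1)`. -/
theorem tendsto_sum_pow_succ_div_pow {q : ℝ} (hq : 1 < |q|) :
    Tendsto (fun n : ℕ => (∑ k : Fin n, q ^ (k.val + 1)) / q ^ n) atTop (nhds (q / (q - 1))) := by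
  have hq0 : q ≠ 0 := by rintro rfl; norm_num at hq
  have hq1 : q ≠ 1 := by rintro rfl; norm_num at hq
  have hsub : q - 1 ≠ 0 := sub_ne_zero.mpr hq1
  have hinv : Tendsto (fun n : ℕ => q⁻¹ ^ n) atTop (nhds 0) :=
    tendsto_pow_atTop_nhds_zero_of_abs_lt_one (by rw [abs_inv]; exact inv_lt_one_of_one_lt₀ hq)
  have hlim : Tendsto (fun n : ℕ => q / (q - 1) * (1 - q⁻¹ ^ n)) atTop (nhds (q / (q - 1))) := by
    simpa using (hinv.const_sub 1).const_mul (q / (q - 1))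
  refine hlim.congr fun n => ?_
  rw [Fin.sum_univ_eq_sum_range (fun k => q ^ (k + 1)) n]
  simp_rw [pow_succ]
  rw [← Finset.sum_mul, geom_sum_eq hq1, inv_pow]
  field_simp

/-- The determinant of `1 + DᵀD` for a two-column matrix `D` whose columns are the combinations
`-(t * a + s * b)` and `a + b` of two vectors `a` and `b`. -/
theorem det_one_add_transpose_mul_self_of_columns {n : ℕ} (s t : ℝ) (a b : Fin n → ℝ)
    (D : Matrix (Fin n) (Fin 2) ℝ) (h0 : ∀ k, D k 0 = -(t * a k + s * b k))
    (h1 : ∀ k, D k 1 = a k + b k) :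
    ((1 : Matrix (Fin 2) (Fin 2) ℝ) + Dᵀ * D).det =
      1 + (t ^ 2 + 1) * ∑ k, a k * a k + 2 * (s * t + 1) * ∑ k, a k * b k
        + (s ^ 2 + 1) * ∑ k, b k * b k
        + (s - t) ^ 2 * ((∑ k, a k * a k) * (∑ k, b k * b k) - (∑ k, a k * b k) ^ 2) := by
  have e00 : ∑ k, D k 0 * D k 0 = t ^ 2 * ∑ k, a k * a k + 2 * s * t * ∑ k, a k * b k
      + s ^ 2 * ∑ k, b k * b k := by
    simp only [Finset.mul_sum, ← Finset.sum_add_distrib, h0]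
    exact Finset.sum_congr rfl fun k _ => by ring
  have e01 : ∑ k, D k 0 * D k 1 = -(t * ∑ k, a k * a k + (s + t) * ∑ k, a k * b k
      + s * ∑ k, b k * b k) := by
    simp only [Finset.mul_sum, ← Finset.sum_add_distrib, ← Finset.sum_neg_distrib, h0, h1]
    exact Finset.sum_congr rfl fun k _ => by ring
  have e10 : ∑ k, D k 1 * D k 0 = ∑ k, D k 0 * D k 1 :=
    Finset.sum_congr rfl fun k _ => mul_comm _ _
  have e11 : ∑ k, D k 1 * D k 1 = ∑ k, a k * a k + 2 * ∑ k, a k * b k + ∑ k, b k * b k := by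
    simp only [Finset.mul_sum, ← Finset.sum_add_distrib, h1]
    exact Finset.sum_congr rfl fun k _ => by ring
  simp only [det_fin_two, Matrix.add_apply, mul_apply, transpose_apply, one_apply_eq,
    one_apply_ne (zero_ne_one : (0 : Fin 2) ≠ 1), one_apply_ne (one_ne_zero : (1 : Fin 2) ≠ 0),
    e10, e00, e01, e11]
  ring

/-- leading-order behaviour of `det(I₂ + DₙᵀDₙ)` (eq. (26)):
`det(I₂ + DₙᵀDₙ)/(γ₁γ₂)^{2n} → Δ γ₁² γ₂²` as `n → ∞`. -/
theorem stmt6 (γ₁ γ₂ ℓ₁ ℓ₂ : ℝ) (h12 : γ₁ ≠ γ₂) (h1 : 1 < |γ₁|) (h2 : 1 < |γ₂|)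
    (hl1 : ℓ₁ ≠ 0) (hl2 : ℓ₂ ≠ 0) :
    let c₁ : ℝ := 1 / (γ₁ * (γ₁ - γ₂))
    let c₂ : ℝ := 1 / (γ₂ * (γ₂ - γ₁))
    let d₁ : ℕ → ℝ := fun k => -(c₁ * γ₂ * ℓ₁ * γ₁ ^ k + c₂ * γ₁ * ℓ₂ * γ₂ ^ k)
    let d₂ : ℕ → ℝ := fun k => c₁ * ℓ₁ * γ₁ ^ k + c₂ * ℓ₂ * γ₂ ^ k
    let L₁₁ : ℝ := c₁ * c₁ * ℓ₁ * ℓ₁ / (γ₁ * γ₁ - 1)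
    let L₂₂ : ℝ := c₂ * c₂ * ℓ₂ * ℓ₂ / (γ₂ * γ₂ - 1)
    let L₁₂ : ℝ := c₁ * c₂ * ℓ₁ * ℓ₂ / (γ₁ * γ₂ - 1)
    let Δ : ℝ := (γ₁ - γ₂) ^ 2 * (L₁₁ * L₂₂ - L₁₂ ^ 2)
    let Dm : (n : ℕ) → Matrix (Fin n) (Fin 2) ℝ := fun n =>
      Matrix.of fun k i => ![d₁ (k.val + 1), d₂ (k.val + 1)] i
    Tendsto (fun n : ℕ =>
        ((1 : Matrix (Fin 2) (Fin 2) ℝ) + (Dm n)ᵀ * Dm n).det /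
          (γ₁ * γ₂) ^ (2 * n))
      atTop (nhds (Δ * γ₁ ^ 2 * γ₂ ^ 2)) := by
  intro c₁ c₂ d₁ d₂ L₁₁ L₂₂ L₁₂ Δ Dm
  have hg1 : γ₁ ≠ 0 := by rintro rfl; norm_num at h1
  have hg2 : γ₂ ≠ 0 := by rintro rfl; norm_num at h2
  have sum_eq (x y p q : ℝ) (n : ℕ) : ∑ k : Fin n, x * p ^ (k.val + 1) * (y * q ^ (k.val + 1)) =
      x * y * ∑ k : Fin n, (p * q) ^ (k.val + 1) := by
    rw [Finset.mul_sum]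
    exact Finset.sum_congr rfl fun k _ => by rw [mul_pow]; ring
  have inv_lim {q : ℝ} (hq : 1 < |q|) : Tendsto (fun n : ℕ => q⁻¹ ^ n) atTop (nhds 0) :=
    tendsto_pow_atTop_nhds_zero_of_abs_lt_one (by rw [abs_inv]; exact inv_lt_one_of_one_lt₀ hq)
  have one_lt_abs_mul {p q : ℝ} (hp : 1 < |p|) (hq : 1 < |q|) : 1 < |p * q| := by
    rw [abs_mul]; exact one_lt_mul_of_lt_of_le hp hq.le
  have hA := (tendsto_sum_pow_succ_div_pow (one_lt_abs_mul h1 h1)).const_mul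
    (c₁ * ℓ₁ * (c₁ * ℓ₁))
  have hB := (tendsto_sum_pow_succ_div_pow (one_lt_abs_mul h2 h2)).const_mul
    (c₂ * ℓ₂ * (c₂ * ℓ₂))
  have hC := (tendsto_sum_pow_succ_div_pow (one_lt_abs_mul h1 h2)).const_mul
    (c₁ * ℓ₁ * (c₂ * ℓ₂))
  have hu := inv_lim h1
  have hv := inv_lim h2
  have key := (((((hu.pow 2).mul (hv.pow 2)).add ((hA.const_mul (γ₂ ^ 2 + 1)).mul (hv.pow 2))).add
    ((hC.const_mul (2 * (γ₁ * γ₂ + 1))).mul (hu.mul hv))).add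
    ((hB.const_mul (γ₁ ^ 2 + 1)).mul (hu.pow 2))).add
    (((hA.mul hB).sub (hC.pow 2)).const_mul ((γ₁ - γ₂) ^ 2))
  convert key using 1
  · funext n
    rw [det_one_add_transpose_mul_self_of_columns γ₁ γ₂
      (fun k : Fin n => c₁ * ℓ₁ * γ₁ ^ (k.val + 1)) (fun k : Fin n => c₂ * ℓ₂ * γ₂ ^ (k.val + 1))
      (Dm n) (fun k => by simp [Dm, d₁]; ring) (fun k => by simp [Dm, d₂])]
    simp only [sum_eq]
    generalize ∑ k : Fin n, (γ₁ * γ₁) ^ (k.val + 1) = A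
    generalize ∑ k : Fin n, (γ₂ * γ₂) ^ (k.val + 1) = B
    generalize ∑ k : Fin n, (γ₁ * γ₂) ^ (k.val + 1) = C
    have hp : γ₁ ^ n ≠ 0 := pow_ne_zero n hg1
    have hq : γ₂ ^ n ≠ 0 := pow_ne_zero n hg2
    rw [mul_comm 2 n, pow_mul]
    simp only [mul_pow, inv_pow]
    generalize γ₁ ^ n = p at hp ⊢
    generalize γ₂ ^ n = q at hq ⊢
    field_simp
  · congr 1
    simp only [Δ, L₁₁, L₂₂, L₁₂]
    ring
end

section
/- The sequence −(1/(2n)) · log( (1 + ∑_{k=1}^n d₂ₖ²)/det(I₂ + DₙᵀDₙ) ) converges to log(min(|γ₁|, |γ₂|)) as n → ∞. -/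
open Matrix Filter

/-- A sequence squeezed between two positive multiples of `r ^ n` has exponential rate `log r`. -/
lemma tendsto_log_div_of_geometric_bounds {f : ℕ → ℝ} {c C r : ℝ} (hc : 0 < c) (hC : 0 < C)
    (hr : 0 < r) (hlow : ∀ᶠ n in atTop, c * r ^ n ≤ f n)
    (hupp : ∀ᶠ n in atTop, f n ≤ C * r ^ n) :
    Tendsto (fun n : ℕ => Real.log (f n) / n) atTop (nhds (Real.log r)) := by
  have key : ∀ a : ℝ, 0 < a →
      Tendsto (fun n : ℕ => Real.log (a * r ^ n) / n) atTop (nhds (Real.log r)) := by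
    intro a ha
    have h : Tendsto (fun n : ℕ => Real.log a / n + Real.log r) atTop (nhds (0 + Real.log r)) :=
      (tendsto_const_div_atTop_nhds_zero_nat _).add tendsto_const_nhds
    rw [zero_add] at h
    refine h.congr' ?_
    filter_upwards [eventually_gt_atTop 0] with n hn
    have hn' : (n : ℝ) ≠ 0 := by positivity
    rw [Real.log_mul ha.ne' (by positivity), Real.log_pow]
    field_simp
  refine tendsto_of_tendsto_of_tendsto_of_le_of_le' (key c hc) (key C hC) ?_ ?_
  · filter_upwards [hlow] with n hn
    have : 0 < c * r ^ n := by positivity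
    gcongr
  · filter_upwards [hlow, hupp] with n hn hn'
    have : 0 < c * r ^ n := by positivity
    have : 0 < f n := this.trans_le hn
    gcongr

lemma sum_range_sq_pow_succ_le {x : ℝ} (hx : 1 < |x|) (n : ℕ) :
    ∑ k ∈ Finset.range n, (x ^ (k + 1)) ^ 2 ≤ x ^ 2 / (x ^ 2 - 1) * (x ^ 2) ^ n := by
  have ht : 0 < x ^ 2 - 1 := by
    rw [← sq_abs]
    nlinarith
  induction n with
  | zero => simp only [Finset.range_zero, Finset.sum_empty]; positivity
  | succ n ih =>
    rw [Finset.sum_range_succ]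
    have : x ^ 2 / (x ^ 2 - 1) * (x ^ 2) ^ (n + 1)
        = x ^ 2 / (x ^ 2 - 1) * (x ^ 2) ^ n + (x ^ (n + 1)) ^ 2 := by
      field_simp
      ring
    rw [this]
    gcongr

/-- The Gram determinant of two finite sequences dominates the square of its last
consecutive `2 × 2` minor. -/
lemma sq_minor_le_gram_det (u v : ℕ → ℝ) (n : ℕ) :
    (u n * v (n + 1) - u (n + 1) * v n) ^ 2 ≤
      (∑ k ∈ Finset.range (n + 2), u k ^ 2) * (∑ k ∈ Finset.range (n + 2), v k ^ 2)
        - (∑ k ∈ Finset.range (n + 2), u k * v k) ^ 2 := by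
  have hcs := Finset.sum_mul_sq_le_sq_mul_sq (Finset.range (n + 1)) u v
  have hminor : (u n * v (n + 1) - u (n + 1) * v n) ^ 2 ≤
      ∑ k ∈ Finset.range (n + 1), (u k * v (n + 1) - u (n + 1) * v k) ^ 2 :=
    Finset.single_le_sum
      (f := fun k => (u k * v (n + 1) - u (n + 1) * v k) ^ 2)
      (fun _ _ => sq_nonneg _) (Finset.self_mem_range_succ n)
  have hexpand : ∑ k ∈ Finset.range (n + 1), (u k * v (n + 1) - u (n + 1) * v k) ^ 2 =
      v (n + 1) ^ 2 * (∑ k ∈ Finset.range (n + 1), u k ^ 2)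
        + u (n + 1) ^ 2 * (∑ k ∈ Finset.range (n + 1), v k ^ 2)
        - 2 * u (n + 1) * v (n + 1) * (∑ k ∈ Finset.range (n + 1), u k * v k) := by
    rw [Finset.mul_sum, Finset.mul_sum, Finset.mul_sum, ← Finset.sum_add_distrib,
      ← Finset.sum_sub_distrib]
    exact Finset.sum_congr rfl fun k _ => by ring
  rw [Finset.sum_range_succ _ (n + 1), Finset.sum_range_succ _ (n + 1),
    Finset.sum_range_succ _ (n + 1)]
  linarith

lemma sum_sq_add_pow_le {x y : ℝ} (hx : 1 < |x|) (hy : 1 < |y|) (a b : ℝ) (n : ℕ) :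
    ∑ k ∈ Finset.range n, (a * x ^ (k + 1) + b * y ^ (k + 1)) ^ 2 ≤
      2 * a ^ 2 * (x ^ 2 / (x ^ 2 - 1)) * (x ^ 2) ^ n
        + 2 * b ^ 2 * (y ^ 2 / (y ^ 2 - 1)) * (y ^ 2) ^ n := by
  calc ∑ k ∈ Finset.range n, (a * x ^ (k + 1) + b * y ^ (k + 1)) ^ 2
      ≤ ∑ k ∈ Finset.range n,
          (2 * a ^ 2 * (x ^ (k + 1)) ^ 2 + 2 * b ^ 2 * (y ^ (k + 1)) ^ 2) :=
        Finset.sum_le_sum fun k _ => by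
          nlinarith [sq_nonneg (a * x ^ (k + 1) - b * y ^ (k + 1))]
    _ = 2 * a ^ 2 * (∑ k ∈ Finset.range n, (x ^ (k + 1)) ^ 2)
          + 2 * b ^ 2 * (∑ k ∈ Finset.range n, (y ^ (k + 1)) ^ 2) := by
        rw [Finset.sum_add_distrib, Finset.mul_sum, Finset.mul_sum]
    _ ≤ 2 * a ^ 2 * (x ^ 2 / (x ^ 2 - 1) * (x ^ 2) ^ n)
          + 2 * b ^ 2 * (y ^ 2 / (y ^ 2 - 1) * (y ^ 2) ^ n) := by
        gcongr
        · exact sum_range_sq_pow_succ_le hx n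
        · exact sum_range_sq_pow_succ_le hy n
    _ = _ := by ring

/-- Two consecutive terms of `a x ^ k + b y ^ k` already control `x ^ (2 n)`. -/
lemma le_sum_sq_add_pow {x y : ℝ} (hx : x ≠ 0) (hy : 1 < |y|) (a b : ℝ) (n : ℕ) :
    (a * (x - y)) ^ 2 / (2 * y ^ 2 * x ^ 2) * (x ^ 2) ^ (n + 2) ≤
      ∑ k ∈ Finset.range (n + 2), (a * x ^ (k + 1) + b * y ^ (k + 1)) ^ 2 := by
  have hy1 : 1 < y ^ 2 := by
    rw [← sq_abs]
    nlinarith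
  rw [Finset.sum_range_succ, Finset.sum_range_succ]
  have h0 : 0 ≤ ∑ k ∈ Finset.range n, (a * x ^ (k + 1) + b * y ^ (k + 1)) ^ 2 :=
    Finset.sum_nonneg fun _ _ => sq_nonneg _
  set v := a * x ^ (n + 1) + b * y ^ (n + 1) with hv
  set u := a * x ^ (n + 1 + 1) + b * y ^ (n + 1 + 1) with hu
  have huv : u - y * v = a * (x - y) * x ^ (n + 1) := by
    rw [hu, hv]
    ring
  have hsq : (u - y * v) ^ 2 ≤ 2 * y ^ 2 * (v ^ 2 + u ^ 2) := by
    nlinarith [sq_nonneg (u + y * v), mul_nonneg (sub_nonneg.2 hy1.le) (sq_nonneg u)]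
  have hlhs : (a * (x - y)) ^ 2 / (2 * y ^ 2 * x ^ 2) * (x ^ 2) ^ (n + 2)
      = (u - y * v) ^ 2 / (2 * y ^ 2) := by
    rw [huv]
    field_simp
    ring
  have : (u - y * v) ^ 2 / (2 * y ^ 2) ≤ v ^ 2 + u ^ 2 := by
    rw [div_le_iff₀ (by positivity)]
    linarith
  linarith

lemma tendsto_log_one_add_sum_sq {x y a b : ℝ} (hxy : x ≠ y) (hx : 1 < |x|) (hy : 1 < |y|)
    (ha : a ≠ 0) (hb : b ≠ 0) :
    Tendsto (fun n : ℕ => Real.log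
        (1 + ∑ k ∈ Finset.range n, (a * x ^ (k + 1) + b * y ^ (k + 1)) ^ 2) / n)
      atTop (nhds (Real.log (max |x| |y| ^ 2))) := by
  wlog hle : |y| ≤ |x| generalizing x y a b
  · have h := this hxy.symm hy hx hb ha (le_of_not_ge hle)
    rw [max_comm]
    simpa only [add_comm (b * _)] using h
  have hx0 : x ≠ 0 := by rintro rfl; norm_num at hx
  have hy0 : y ≠ 0 := by rintro rfl; norm_num at hy
  have hx1 : 1 < x ^ 2 := by rw [← sq_abs]; nlinarith
  have hy1 : 1 < y ^ 2 := by rw [← sq_abs]; nlinarith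
  have hyx : y ^ 2 ≤ x ^ 2 := sq_le_sq.2 hle
  have hx2 : 0 < x ^ 2 - 1 := by linarith
  have hy2 : 0 < y ^ 2 - 1 := by linarith
  have hsub : x - y ≠ 0 := sub_ne_zero.2 hxy
  rw [max_eq_left hle, sq_abs]
  refine tendsto_log_div_of_geometric_bounds
    (c := (a * (x - y)) ^ 2 / (2 * y ^ 2 * x ^ 2))
    (C := 1 + 2 * a ^ 2 * (x ^ 2 / (x ^ 2 - 1)) + 2 * b ^ 2 * (y ^ 2 / (y ^ 2 - 1)))
    (by positivity) (by positivity) (by positivity) ?_ ?_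
  · filter_upwards [eventually_ge_atTop 2] with n hn
    obtain ⟨m, rfl⟩ := Nat.exists_eq_add_of_le' hn
    linarith [le_sum_sq_add_pow hx0 hy a b m]
  · refine Eventually.of_forall fun n => ?_
    have h1 : 1 ≤ (x ^ 2) ^ n := one_le_pow₀ hx1.le
    have h2 : 2 * b ^ 2 * (y ^ 2 / (y ^ 2 - 1)) * (y ^ 2) ^ n
        ≤ 2 * b ^ 2 * (y ^ 2 / (y ^ 2 - 1)) * (x ^ 2) ^ n := by gcongr
    linarith [sum_sq_add_pow_le hx hy a b n]

lemma gram_det_add_pow_le {x y : ℝ} (hx : 1 < |x|) (hy : 1 < |y|) (a b p q : ℝ) (n : ℕ) :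
    (∑ k ∈ Finset.range n, (p * x ^ (k + 1) + q * y ^ (k + 1)) ^ 2)
        * (∑ k ∈ Finset.range n, (a * x ^ (k + 1) + b * y ^ (k + 1)) ^ 2)
      - (∑ k ∈ Finset.range n,
          (p * x ^ (k + 1) + q * y ^ (k + 1)) * (a * x ^ (k + 1) + b * y ^ (k + 1))) ^ 2
      ≤ (p * b - q * a) ^ 2 * (x ^ 2 / (x ^ 2 - 1)) * (y ^ 2 / (y ^ 2 - 1))
          * (x ^ 2 * y ^ 2) ^ n := by
  have hbil : ∀ p q a b : ℝ, ∑ k ∈ Finset.range n,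
      (p * x ^ (k + 1) + q * y ^ (k + 1)) * (a * x ^ (k + 1) + b * y ^ (k + 1)) =
      p * a * (∑ k ∈ Finset.range n, (x ^ (k + 1)) ^ 2)
        + q * b * (∑ k ∈ Finset.range n, (y ^ (k + 1)) ^ 2)
        + (p * b + q * a) * (∑ k ∈ Finset.range n, x ^ (k + 1) * y ^ (k + 1)) := by
    intro p q a b
    rw [Finset.mul_sum, Finset.mul_sum, Finset.mul_sum, ← Finset.sum_add_distrib,
      ← Finset.sum_add_distrib]
    exact Finset.sum_congr rfl fun k _ => by ring
  have hA := sum_range_sq_pow_succ_le hx n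
  have hB := sum_range_sq_pow_succ_le hy n
  simp only [sq (_ * _ + _ * _), hbil]
  have hA0 : 0 ≤ ∑ k ∈ Finset.range n, (x ^ (k + 1)) ^ 2 :=
    Finset.sum_nonneg fun _ _ => sq_nonneg _
  have hB0 : 0 ≤ ∑ k ∈ Finset.range n, (y ^ (k + 1)) ^ 2 :=
    Finset.sum_nonneg fun _ _ => sq_nonneg _
  set A := ∑ k ∈ Finset.range n, (x ^ (k + 1)) ^ 2
  set B := ∑ k ∈ Finset.range n, (y ^ (k + 1)) ^ 2
  set C := ∑ k ∈ Finset.range n, x ^ (k + 1) * y ^ (k + 1)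
  have hAB := mul_le_mul hA hB hB0 (hA0.trans hA)
  calc _ = (p * b - q * a) ^ 2 * (A * B) - ((p * b - q * a) * C) ^ 2 := by ring
    _ ≤ (p * b - q * a) ^ 2 * (A * B) := sub_le_self _ (sq_nonneg _)
    _ ≤ (p * b - q * a) ^ 2 * (x ^ 2 / (x ^ 2 - 1) * (x ^ 2) ^ n
          * (y ^ 2 / (y ^ 2 - 1) * (y ^ 2) ^ n)) := by gcongr
    _ = _ := by
      rw [mul_pow]
      ring

lemma tendsto_log_one_add_gram {x y a b p q : ℝ} (hxy : x ≠ y) (hx : 1 < |x|) (hy : 1 < |y|)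
    (hdet : p * b - q * a ≠ 0) :
    Tendsto (fun n : ℕ => Real.log
        ((1 + ∑ k ∈ Finset.range n, (p * x ^ (k + 1) + q * y ^ (k + 1)) ^ 2)
            * (1 + ∑ k ∈ Finset.range n, (a * x ^ (k + 1) + b * y ^ (k + 1)) ^ 2)
          - (∑ k ∈ Finset.range n, (p * x ^ (k + 1) + q * y ^ (k + 1))
              * (a * x ^ (k + 1) + b * y ^ (k + 1))) ^ 2) / n)
      atTop (nhds (Real.log (x ^ 2 * y ^ 2))) := by
  have hx0 : x ≠ 0 := by rintro rfl; norm_num at hx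
  have hy0 : y ≠ 0 := by rintro rfl; norm_num at hy
  have hx1 : 1 < x ^ 2 := by rw [← sq_abs]; nlinarith
  have hy1 : 1 < y ^ 2 := by rw [← sq_abs]; nlinarith
  have hx2 : 0 < x ^ 2 - 1 := by linarith
  have hy2 : 0 < y ^ 2 - 1 := by linarith
  have hsub : x - y ≠ 0 := sub_ne_zero.2 hxy
  refine tendsto_log_div_of_geometric_bounds
    (c := ((p * b - q * a) * (x - y)) ^ 2 / (x ^ 2 * y ^ 2))
    (C := 1 + (2 * p ^ 2 + 2 * a ^ 2) * (x ^ 2 / (x ^ 2 - 1))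
      + (2 * q ^ 2 + 2 * b ^ 2) * (y ^ 2 / (y ^ 2 - 1))
      + (p * b - q * a) ^ 2 * (x ^ 2 / (x ^ 2 - 1)) * (y ^ 2 / (y ^ 2 - 1)))
    (by positivity) (by positivity) (by positivity) ?_ ?_
  · filter_upwards [eventually_ge_atTop 2] with n hn
    obtain ⟨m, rfl⟩ := Nat.exists_eq_add_of_le' hn
    have hg := sq_minor_le_gram_det (fun k => p * x ^ (k + 1) + q * y ^ (k + 1))
      (fun k => a * x ^ (k + 1) + b * y ^ (k + 1)) m
    have hu : 0 ≤ ∑ k ∈ Finset.range (m + 2), (p * x ^ (k + 1) + q * y ^ (k + 1)) ^ 2 :=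
      Finset.sum_nonneg fun _ _ => sq_nonneg _
    have hv : 0 ≤ ∑ k ∈ Finset.range (m + 2), (a * x ^ (k + 1) + b * y ^ (k + 1)) ^ 2 :=
      Finset.sum_nonneg fun _ _ => sq_nonneg _
    have hc : ((p * b - q * a) * (x - y)) ^ 2 / (x ^ 2 * y ^ 2) * (x ^ 2 * y ^ 2) ^ (m + 2)
        = ((p * x ^ (m + 1) + q * y ^ (m + 1)) * (a * x ^ (m + 1 + 1) + b * y ^ (m + 1 + 1))
          - (p * x ^ (m + 1 + 1) + q * y ^ (m + 1 + 1))
            * (a * x ^ (m + 1) + b * y ^ (m + 1))) ^ 2 := by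
      field_simp
      ring
    rw [hc]
    linarith
  · refine Eventually.of_forall fun n => ?_
    have hxn : 1 ≤ (x ^ 2) ^ n := one_le_pow₀ hx1.le
    have hyn : 1 ≤ (y ^ 2) ^ n := one_le_pow₀ hy1.le
    have hxr : (x ^ 2) ^ n ≤ (x ^ 2 * y ^ 2) ^ n := by
      rw [mul_pow]; exact le_mul_of_one_le_right (by positivity) hyn
    have hyr : (y ^ 2) ^ n ≤ (x ^ 2 * y ^ 2) ^ n := by
      rw [mul_pow]; exact le_mul_of_one_le_left (by positivity) hxn
    have hX : (2 * p ^ 2 + 2 * a ^ 2) * (x ^ 2 / (x ^ 2 - 1)) * (x ^ 2) ^ n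
        ≤ (2 * p ^ 2 + 2 * a ^ 2) * (x ^ 2 / (x ^ 2 - 1)) * (x ^ 2 * y ^ 2) ^ n := by
      gcongr
    have hY : (2 * q ^ 2 + 2 * b ^ 2) * (y ^ 2 / (y ^ 2 - 1)) * (y ^ 2) ^ n
        ≤ (2 * q ^ 2 + 2 * b ^ 2) * (y ^ 2 / (y ^ 2 - 1)) * (x ^ 2 * y ^ 2) ^ n := by
      gcongr
    linarith [sum_sq_add_pow_le hx hy a b n, sum_sq_add_pow_le hx hy p q n,
      gram_det_add_pow_le hx hy a b p q n]

/-- The determinant of `I + DᵀD` for an `n × 2` matrix `D` given by its two columns. -/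
lemma det_one_add_transpose_mul_self (u v : ℕ → ℝ) (n : ℕ) :
    ((1 : Matrix (Fin 2) (Fin 2) ℝ)
        + (Matrix.of fun (k : Fin n) (i : Fin 2) => ![u k.val, v k.val] i)ᵀ
          * Matrix.of fun (k : Fin n) (i : Fin 2) => ![u k.val, v k.val] i).det =
      (1 + ∑ k ∈ Finset.range n, u k ^ 2) * (1 + ∑ k ∈ Finset.range n, v k ^ 2)
        - (∑ k ∈ Finset.range n, u k * v k) ^ 2 := by
  rw [Matrix.det_fin_two]
  simp [Matrix.mul_apply, Finset.sum_range, sq, mul_comm]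

/-- rate of convergence of the MMSE (eq. (29)):
`−(1/(2n)) log((1 + ∑_{k=1}^n d₂ₖ²)/det(I₂ + DₙᵀDₙ)) → log(min(|γ₁|, |γ₂|))`. -/
theorem stmt7 (γ₁ γ₂ ℓ₁ ℓ₂ : ℝ) (h12 : γ₁ ≠ γ₂) (h1 : 1 < |γ₁|) (h2 : 1 < |γ₂|)
    (hl1 : ℓ₁ ≠ 0) (hl2 : ℓ₂ ≠ 0) :
    let c₁ : ℝ := 1 / (γ₁ * (γ₁ - γ₂))
    let c₂ : ℝ := 1 / (γ₂ * (γ₂ - γ₁))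
    let d₁ : ℕ → ℝ := fun k => -(c₁ * γ₂ * ℓ₁ * γ₁ ^ k + c₂ * γ₁ * ℓ₂ * γ₂ ^ k)
    let d₂ : ℕ → ℝ := fun k => c₁ * ℓ₁ * γ₁ ^ k + c₂ * ℓ₂ * γ₂ ^ k
    let Dm : (n : ℕ) → Matrix (Fin n) (Fin 2) ℝ := fun n =>
      Matrix.of fun k i => ![d₁ (k.val + 1), d₂ (k.val + 1)] i
    Tendsto (fun n : ℕ =>
        -(1 / (2 * (n : ℝ))) *
          Real.log ((1 + ∑ k ∈ Finset.Icc 1 n, (d₂ k) ^ 2) /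
            ((1 : Matrix (Fin 2) (Fin 2) ℝ) + (Dm n)ᵀ * Dm n).det))
      atTop (nhds (Real.log (min |γ₁| |γ₂|))) := by
  intro c₁ c₂ d₁ d₂ Dm
  have hx0 : γ₁ ≠ 0 := by rintro rfl; norm_num at h1
  have hy0 : γ₂ ≠ 0 := by rintro rfl; norm_num at h2
  have hsub : γ₁ - γ₂ ≠ 0 := sub_ne_zero.2 h12
  have ha : c₁ * ℓ₁ ≠ 0 := mul_ne_zero (one_div_ne_zero (mul_ne_zero hx0 hsub)) hl1
  have hb : c₂ * ℓ₂ ≠ 0 :=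
    mul_ne_zero (one_div_ne_zero (mul_ne_zero hy0 (sub_ne_zero.2 h12.symm))) hl2
  have hdet : -(c₁ * γ₂ * ℓ₁) * (c₂ * ℓ₂) - -(c₂ * γ₁ * ℓ₂) * (c₁ * ℓ₁) ≠ 0 := by
    have : -(c₁ * γ₂ * ℓ₁) * (c₂ * ℓ₂) - -(c₂ * γ₁ * ℓ₂) * (c₁ * ℓ₁)
        = (c₁ * ℓ₁) * (c₂ * ℓ₂) * (γ₁ - γ₂) := by ring
    rw [this]
    exact mul_ne_zero (mul_ne_zero ha hb) hsub
  have hnum := tendsto_log_one_add_sum_sq h12 h1 h2 ha hb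
  have hden := tendsto_log_one_add_gram h12 h1 h2 hdet
  have hlim : (Real.log (γ₁ ^ 2 * γ₂ ^ 2) - Real.log (max |γ₁| |γ₂| ^ 2)) / 2
      = Real.log (min |γ₁| |γ₂|) := by
    have hmin : 0 < min |γ₁| |γ₂| := lt_min (by positivity) (by positivity)
    have hmax : 0 < max |γ₁| |γ₂| := lt_max_of_lt_left (by positivity)
    have : γ₁ ^ 2 * γ₂ ^ 2 = (min |γ₁| |γ₂| * max |γ₁| |γ₂|) ^ 2 := by
      rw [min_mul_max, mul_pow, sq_abs, sq_abs]
    rw [this, Real.log_pow, Real.log_pow, Real.log_mul hmin.ne' hmax.ne']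
    push_cast
    ring
  rw [← hlim]
  refine ((hden.sub hnum).div_const 2).congr fun n => ?_
  have hd₁ : ∀ k, -(c₁ * γ₂ * ℓ₁) * γ₁ ^ k + -(c₂ * γ₁ * ℓ₂) * γ₂ ^ k = d₁ k := by
    intro k
    simp only [d₁]
    ring
  have hd₂ : ∀ k, c₁ * ℓ₁ * γ₁ ^ k + c₂ * ℓ₂ * γ₂ ^ k = d₂ k := fun _ => rfl
  simp only [hd₁, hd₂]
  have hIcc : ∑ k ∈ Finset.Icc 1 n, d₂ k ^ 2 = ∑ k ∈ Finset.range n, d₂ (k + 1) ^ 2 := by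
    rw [Finset.range_eq_Ico, Finset.sum_Ico_add' (fun k => d₂ k ^ 2) 0 n 1]
    rfl
  have hD := det_one_add_transpose_mul_self (fun k => d₁ (k + 1)) (fun k => d₂ (k + 1)) n
  have hS₁ : 0 ≤ ∑ k ∈ Finset.range n, d₁ (k + 1) ^ 2 :=
    Finset.sum_nonneg fun _ _ => sq_nonneg _
  have hS₂ : 0 ≤ ∑ k ∈ Finset.range n, d₂ (k + 1) ^ 2 :=
    Finset.sum_nonneg fun _ _ => sq_nonneg _
  have hcs := Finset.sum_mul_sq_le_sq_mul_sq (Finset.range n)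
    (fun k => d₁ (k + 1)) (fun k => d₂ (k + 1))
  have hpos : 0 < (1 + ∑ k ∈ Finset.range n, d₁ (k + 1) ^ 2)
      * (1 + ∑ k ∈ Finset.range n, d₂ (k + 1) ^ 2)
        - (∑ k ∈ Finset.range n, d₁ (k + 1) * d₂ (k + 1)) ^ 2 := by
    linarith
  rw [hIcc, hD, Real.log_div (by positivity) hpos.ne']
  ring
end

section
/- The sequence (aₙ² + bₙ² + ∑_{k=1}^{n−1}(aₙd₂ₖ − bₙd₁ₖ)²)/det(I₂ + Dₙ₋₁ᵀDₙ₋₁) converges, as n → ∞, to (1/Δ)·(L₁₁/γ₂² + L₂₂/γ₁² + 2L₁₂/(γ₁γ₂)). -/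
open Matrix Filter

theorem sum_fin_succ_eq_sum_Icc (f : ℕ → ℝ) (n : ℕ) :
    ∑ k : Fin n, f (k.val + 1) = ∑ k ∈ Finset.Icc 1 n, f k := by
  rw [Fin.sum_univ_eq_sum_range (fun k => f (k + 1)) n, Finset.range_eq_Ico,
    Finset.sum_Ico_add' f 0 n 1]
  rfl

theorem det_one_add_gram (f g : ℕ → ℝ) (n : ℕ) (D : Matrix (Fin n) (Fin 2) ℝ)
    (hD : D = Matrix.of fun k i => ![f (k.val + 1), g (k.val + 1)] i) :
    ((1 : Matrix (Fin 2) (Fin 2) ℝ) + Dᵀ * D).det =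
      (1 + ∑ k ∈ Finset.Icc 1 n, f k ^ 2) * (1 + ∑ k ∈ Finset.Icc 1 n, g k ^ 2) -
        (∑ k ∈ Finset.Icc 1 n, f k * g k) ^ 2 := by
  subst hD
  rw [← sum_fin_succ_eq_sum_Icc (fun k => f k ^ 2), ← sum_fin_succ_eq_sum_Icc (fun k => g k ^ 2),
    ← sum_fin_succ_eq_sum_Icc (fun k => f k * g k)]
  simp only [Matrix.det_fin_two, Matrix.add_apply, Matrix.mul_apply, Matrix.transpose_apply,
    Matrix.of_apply, Matrix.one_apply_eq, Matrix.cons_val_zero, Matrix.cons_val_one, ne_eq,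
    zero_ne_one, one_ne_zero, not_false_eq_true, Matrix.one_apply_ne, zero_add, pow_two]
  simp only [mul_comm (g _) (f _)]

theorem sum_Icc_pow_eq {r : ℝ} (hr : r ≠ 1) (n : ℕ) :
    ∑ k ∈ Finset.Icc 1 n, r ^ k = r * (r ^ n - 1) / (r - 1) := by
  rw [← sum_fin_succ_eq_sum_Icc (fun k => r ^ k),
    Fin.sum_univ_eq_sum_range (fun k => r ^ (k + 1)) n]
  simp_rw [pow_succ', ← Finset.mul_sum]
  rw [geom_sum_eq hr, mul_div_assoc]

theorem sum_Icc_two_exp_mul (p q s t s' t' : ℝ) (n : ℕ) :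
    ∑ k ∈ Finset.Icc 1 n, (s * p ^ k + t * q ^ k) * (s' * p ^ k + t' * q ^ k) =
      s * s' * ∑ k ∈ Finset.Icc 1 n, (p * p) ^ k + t * t' * ∑ k ∈ Finset.Icc 1 n, (q * q) ^ k +
        (s * t' + t * s') * ∑ k ∈ Finset.Icc 1 n, (p * q) ^ k := by
  simp only [Finset.mul_sum, ← Finset.sum_add_distrib]
  refine Finset.sum_congr rfl fun k _ => ?_
  simp only [mul_pow]
  ring

theorem mul_sub_one_pos_of_one_lt_abs {p : ℝ} (hp : 1 < |p|) : 0 < p * p - 1 := by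
  have := abs_mul_abs_self p
  nlinarith

theorem mul_ne_one_of_one_lt_abs {p q : ℝ} (hp : 1 < |p|) (hq : 1 < |q|) : p * q ≠ 1 := by
  intro h
  have h' : |p| * |q| = 1 := by rw [← abs_mul, h, abs_one]
  nlinarith

theorem tendsto_inv_pow_of_one_lt_abs {p : ℝ} (hp : 1 < |p|) :
    Tendsto (fun n : ℕ => (p ^ n)⁻¹) atTop (nhds 0) := by
  simp_rw [← inv_pow]
  refine tendsto_pow_atTop_nhds_zero_of_abs_lt_one ?_
  rw [abs_inv]
  exact inv_lt_one_of_one_lt₀ hp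

/-- In the variables `x = p⁻ⁿ`, `y = q⁻ⁿ`, the numerator at `n + 1` divided by `(pq)²ⁿ`. -/
noncomputable def scaledNum (p q l m c e x y : ℝ) : ℝ :=
  (c * q * p * y + e * p * q * x) ^ 2 + (c * p * y + e * q * x) ^ 2 +
    (p - q) ^ 2 * c ^ 2 * e ^ 2 * (p * q) ^ 2 *
      (m ^ 2 * ((1 - y ^ 2) / (q * q - 1)) + l ^ 2 * ((1 - x ^ 2) / (p * p - 1)) -
        2 * l * m * ((1 - x * y) / (p * q - 1)))

/-- In the variables `x = p⁻ⁿ`, `y = q⁻ⁿ`, the determinant at `n` divided by `(pq)²ⁿ`. -/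
noncomputable def scaledDet (p q u v x y : ℝ) : ℝ :=
  x ^ 2 * y ^ 2 + (q ^ 2 + 1) * u ^ 2 * (p * p * ((1 - x ^ 2) / (p * p - 1))) * y ^ 2 +
    (p ^ 2 + 1) * v ^ 2 * (q * q * ((1 - y ^ 2) / (q * q - 1))) * x ^ 2 +
    2 * u * v * (p * q + 1) * (p * q * ((1 - x * y) / (p * q - 1))) * (x * y) +
    (p - q) ^ 2 * u ^ 2 * v ^ 2 * (p * q) ^ 2 *
      ((1 - x ^ 2) / (p * p - 1) * ((1 - y ^ 2) / (q * q - 1)) - ((1 - x * y) / (p * q - 1)) ^ 2)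

theorem num_eq_scaledNum {p q : ℝ} (hp : 1 < |p|) (hq : 1 < |q|) (l m c e : ℝ) (n : ℕ) :
    (-(c * q * p ^ (n + 1) + e * p * q ^ (n + 1))) ^ 2 +
        (c * p ^ (n + 1) + e * q ^ (n + 1)) ^ 2 +
        ∑ k ∈ Finset.Icc 1 n,
          (-(c * q * p ^ (n + 1) + e * p * q ^ (n + 1)) * (c * l * p ^ k + e * m * q ^ k) -
            (c * p ^ (n + 1) + e * q ^ (n + 1)) *
              -(c * q * l * p ^ k + e * p * m * q ^ k)) ^ 2 =
      (p ^ n * q ^ n) ^ 2 * scaledNum p q l m c e (p ^ n)⁻¹ (q ^ n)⁻¹ := by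
  have hp0 : p ≠ 0 := by rintro rfl; norm_num at hp
  have hq0 : q ≠ 0 := by rintro rfl; norm_num at hq
  have hpp := (mul_sub_one_pos_of_one_lt_abs hp).ne'
  have hqq := (mul_sub_one_pos_of_one_lt_abs hq).ne'
  have hpq := sub_ne_zero.2 (mul_ne_one_of_one_lt_abs hp hq)
  have hsum := sum_Icc_two_exp_mul p q (-((p - q) * c * e * l * q ^ (n + 1)))
    ((p - q) * c * e * m * p ^ (n + 1)) (-((p - q) * c * e * l * q ^ (n + 1)))
    ((p - q) * c * e * m * p ^ (n + 1)) n
  rw [sum_Icc_pow_eq (sub_ne_zero.1 hpp), sum_Icc_pow_eq (sub_ne_zero.1 hqq),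
    sum_Icc_pow_eq (sub_ne_zero.1 hpq)] at hsum
  rw [Finset.sum_congr rfl (fun k _ => show _ =
    (-((p - q) * c * e * l * q ^ (n + 1)) * p ^ k + (p - q) * c * e * m * p ^ (n + 1) * q ^ k) *
    (-((p - q) * c * e * l * q ^ (n + 1)) * p ^ k + (p - q) * c * e * m * p ^ (n + 1) * q ^ k)
      by ring), hsum]
  have hP : p ^ n ≠ 0 := pow_ne_zero n hp0
  have hQ : q ^ n ≠ 0 := pow_ne_zero n hq0
  simp only [mul_pow, pow_succ, scaledNum]
  generalize p ^ n = P at *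
  generalize q ^ n = Q at *
  simp only [div_eq_mul_inv]
  generalize (p * p - 1)⁻¹ = A at *
  generalize (q * q - 1)⁻¹ = B at *
  generalize (p * q - 1)⁻¹ = C at *
  field_simp
  ring

theorem det_eq_scaledDet {p q : ℝ} (hp : 1 < |p|) (hq : 1 < |q|) (l m c e : ℝ) (n : ℕ)
    (D : Matrix (Fin n) (Fin 2) ℝ)
    (hD : D = Matrix.of fun k i =>
      ![-(c * q * l * p ^ (k.val + 1) + e * p * m * q ^ (k.val + 1)),
        c * l * p ^ (k.val + 1) + e * m * q ^ (k.val + 1)] i) :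
    ((1 : Matrix (Fin 2) (Fin 2) ℝ) + Dᵀ * D).det =
      (p ^ n * q ^ n) ^ 2 * scaledDet p q (c * l) (e * m) (p ^ n)⁻¹ (q ^ n)⁻¹ := by
  have hp0 : p ≠ 0 := by rintro rfl; norm_num at hp
  have hq0 : q ≠ 0 := by rintro rfl; norm_num at hq
  have hpp := (mul_sub_one_pos_of_one_lt_abs hp).ne'
  have hqq := (mul_sub_one_pos_of_one_lt_abs hq).ne'
  have hpq := sub_ne_zero.2 (mul_ne_one_of_one_lt_abs hp hq)
  rw [det_one_add_gram (fun k => -(c * q * l * p ^ k + e * p * m * q ^ k))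
    (fun k => c * l * p ^ k + e * m * q ^ k) n D hD]
  have hff := sum_Icc_two_exp_mul p q (c * q * l) (e * p * m) (c * q * l) (e * p * m) n
  have hgg := sum_Icc_two_exp_mul p q (c * l) (e * m) (c * l) (e * m) n
  have hfg := sum_Icc_two_exp_mul p q (c * q * l) (e * p * m) (c * l) (e * m) n
  rw [sum_Icc_pow_eq (sub_ne_zero.1 hpp), sum_Icc_pow_eq (sub_ne_zero.1 hqq),
    sum_Icc_pow_eq (sub_ne_zero.1 hpq)] at hff hgg hfg
  simp only [neg_sq, neg_mul, Finset.sum_neg_distrib]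
  simp only [pow_two (_ + _), hff, hgg, hfg]
  have hP : p ^ n ≠ 0 := pow_ne_zero n hp0
  have hQ : q ^ n ≠ 0 := pow_ne_zero n hq0
  simp only [mul_pow, scaledDet]
  generalize p ^ n = P at *
  generalize q ^ n = Q at *
  simp only [div_eq_mul_inv]
  generalize (p * p - 1)⁻¹ = A at *
  generalize (q * q - 1)⁻¹ = B at *
  generalize (p * q - 1)⁻¹ = C at *
  field_simp
  ring

theorem scaledDet_zero_ne_zero {p q u v : ℝ} (hp : 1 < |p|) (hq : 1 < |q|) (h : p ≠ q)
    (hu : u ≠ 0) (hv : v ≠ 0) : scaledDet p q u v 0 0 ≠ 0 := by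
  have hp0 : p ≠ 0 := by rintro rfl; norm_num at hp
  have hq0 : q ≠ 0 := by rintro rfl; norm_num at hq
  have hpp := (mul_sub_one_pos_of_one_lt_abs hp).ne'
  have hqq := (mul_sub_one_pos_of_one_lt_abs hq).ne'
  have hpq := sub_ne_zero.2 (mul_ne_one_of_one_lt_abs hp hq)
  have hne := sub_ne_zero.2 h
  have heq : scaledDet p q u v 0 0 = (p - q) ^ 4 * u ^ 2 * v ^ 2 * (p * q) ^ 2 /
      ((p * p - 1) * (q * q - 1) * (p * q - 1) ^ 2) := by
    unfold scaledDet
    generalize hA : p * p - 1 = A at *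
    generalize hB : q * q - 1 = B at *
    generalize hC : p * q - 1 = C at *
    field_simp
    simp only [← hA, ← hB, ← hC]
    ring
  rw [heq]
  positivity

/-- limiting power usage of the SK(2) scheme in Case A:
`(aₙ² + bₙ² + ∑_{k=1}^{n−1}(aₙ d₂ₖ − bₙ d₁ₖ)²)/det(I₂ + Dₙ₋₁ᵀDₙ₋₁)`
converges to `(1/Δ)(L₁₁/γ₂² + L₂₂/γ₁² + 2L₁₂/(γ₁γ₂))`. -/
theorem stmt8 (γ₁ γ₂ ℓ₁ ℓ₂ : ℝ) (h12 : γ₁ ≠ γ₂) (h1 : 1 < |γ₁|) (h2 : 1 < |γ₂|)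
    (hl1 : ℓ₁ ≠ 0) (hl2 : ℓ₂ ≠ 0) :
    let c₁ : ℝ := 1 / (γ₁ * (γ₁ - γ₂))
    let c₂ : ℝ := 1 / (γ₂ * (γ₂ - γ₁))
    let d₁ : ℕ → ℝ := fun k => -(c₁ * γ₂ * ℓ₁ * γ₁ ^ k + c₂ * γ₁ * ℓ₂ * γ₂ ^ k)
    let d₂ : ℕ → ℝ := fun k => c₁ * ℓ₁ * γ₁ ^ k + c₂ * ℓ₂ * γ₂ ^ k
    let a : ℕ → ℝ := fun n => -(c₁ * γ₂ * γ₁ ^ n + c₂ * γ₁ * γ₂ ^ n)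
    let b : ℕ → ℝ := fun n => c₁ * γ₁ ^ n + c₂ * γ₂ ^ n
    let L₁₁ : ℝ := c₁ * c₁ * ℓ₁ * ℓ₁ / (γ₁ * γ₁ - 1)
    let L₂₂ : ℝ := c₂ * c₂ * ℓ₂ * ℓ₂ / (γ₂ * γ₂ - 1)
    let L₁₂ : ℝ := c₁ * c₂ * ℓ₁ * ℓ₂ / (γ₁ * γ₂ - 1)
    let Δ : ℝ := (γ₁ - γ₂) ^ 2 * (L₁₁ * L₂₂ - L₁₂ ^ 2)
    let Dm : (n : ℕ) → Matrix (Fin n) (Fin 2) ℝ := fun n =>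
      Matrix.of fun k i => ![d₁ (k.val + 1), d₂ (k.val + 1)] i
    Tendsto (fun n : ℕ =>
        (a n ^ 2 + b n ^ 2 +
            ∑ k ∈ Finset.Icc 1 (n - 1), (a n * d₂ k - b n * d₁ k) ^ 2) /
          ((1 : Matrix (Fin 2) (Fin 2) ℝ) + (Dm (n - 1))ᵀ * Dm (n - 1)).det)
      atTop
      (nhds ((1 / Δ) * (L₁₁ / γ₂ ^ 2 + L₂₂ / γ₁ ^ 2 + 2 * L₁₂ / (γ₁ * γ₂)))) := by
  intro c₁ c₂ d₁ d₂ a b L₁₁ L₂₂ L₁₂ Δ Dm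
  have hp0 : γ₁ ≠ 0 := by rintro rfl; norm_num at h1
  have hq0 : γ₂ ≠ 0 := by rintro rfl; norm_num at h2
  have hne := sub_ne_zero.2 h12
  have hne' := sub_ne_zero.2 h12.symm
  have hc₁ : c₁ ≠ 0 := one_div_ne_zero (mul_ne_zero hp0 hne)
  have hc₂ : c₂ ≠ 0 := one_div_ne_zero (mul_ne_zero hq0 hne')
  have hdet := scaledDet_zero_ne_zero h1 h2 h12 (mul_ne_zero hc₁ hl1) (mul_ne_zero hc₂ hl2)
  have hxy := (tendsto_inv_pow_of_one_lt_abs h1).prodMk_nhds (tendsto_inv_pow_of_one_lt_abs h2)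
  have hN : Continuous fun z : ℝ × ℝ => scaledNum γ₁ γ₂ ℓ₁ ℓ₂ c₁ c₂ z.1 z.2 := by
    unfold scaledNum; fun_prop
  have hD : Continuous fun z : ℝ × ℝ => scaledDet γ₁ γ₂ (c₁ * ℓ₁) (c₂ * ℓ₂) z.1 z.2 := by
    unfold scaledDet; fun_prop
  have hlim := ((hN.tendsto (0, 0)).comp hxy).div ((hD.tendsto (0, 0)).comp hxy) hdet
  have hval : scaledNum γ₁ γ₂ ℓ₁ ℓ₂ c₁ c₂ 0 0 / scaledDet γ₁ γ₂ (c₁ * ℓ₁) (c₂ * ℓ₂) 0 0 =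
      (1 / Δ) * (L₁₁ / γ₂ ^ 2 + L₂₂ / γ₁ ^ 2 + 2 * L₁₂ / (γ₁ * γ₂)) := by
    have hden : scaledDet γ₁ γ₂ (c₁ * ℓ₁) (c₂ * ℓ₂) 0 0 = (γ₁ * γ₂) ^ 2 * Δ := by
      simp only [scaledDet, Δ, L₁₁, L₂₂, L₁₂]
      ring
    have h₁ : c₁ * (γ₁ - γ₂) = 1 / γ₁ := by simp only [c₁]; field_simp
    have h₂ : c₂ * (γ₁ - γ₂) = -(1 / γ₂) := by
      simp only [c₂]; field_simp; ring
    have hnum : scaledNum γ₁ γ₂ ℓ₁ ℓ₂ c₁ c₂ 0 0 =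
        (γ₁ * γ₂) ^ 2 * (L₁₁ / γ₂ ^ 2 + L₂₂ / γ₁ ^ 2 + 2 * L₁₂ / (γ₁ * γ₂)) := by
      have hexp : scaledNum γ₁ γ₂ ℓ₁ ℓ₂ c₁ c₂ 0 0 = (γ₁ * γ₂) ^ 2 *
          (L₁₁ * (c₂ * (γ₁ - γ₂)) ^ 2 + L₂₂ * (c₁ * (γ₁ - γ₂)) ^ 2 -
            2 * L₁₂ * ((c₁ * (γ₁ - γ₂)) * (c₂ * (γ₁ - γ₂)))) := by
        simp only [scaledNum, L₁₁, L₂₂, L₁₂]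
        ring
      rw [hexp, h₁, h₂]
      ring
    rw [hden, hnum, mul_div_mul_left _ _ (pow_ne_zero 2 (mul_ne_zero hp0 hq0)), one_div_mul_eq_div]
  rw [← hval, ← tendsto_add_atTop_iff_nat 1]
  refine hlim.congr fun n => ?_
  refine Eq.trans ?_ (congrArg₂ (· / ·) (num_eq_scaledNum h1 h2 ℓ₁ ℓ₂ c₁ c₂ n)
    (det_eq_scaledDet h1 h2 ℓ₁ ℓ₂ c₁ c₂ n (Dm n) rfl)).symm
  exact (mul_div_mul_left _ _
    (pow_ne_zero 2 (mul_ne_zero (pow_ne_zero n hp0) (pow_ne_zero n hq0)))).symm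
end

section
/- The sequence −(1/(2n)) · log( (1 + ∑_{k=1}^n d₂ₖ²)/det(I₂ + DₙᵀDₙ) ) converges to log|γ| as n → ∞. -/
open Matrix Filter

/-- A sequence which is `x ^ n` up to polynomial factors has exponential growth rate `log x`. -/
lemma tendsto_log_div_of_le_of_le {f : ℕ → ℝ} {x c C : ℝ} (p : ℕ) (hx : 0 < x) (hc : 0 < c)
    (hC : 0 < C) (hlow : ∀ᶠ n : ℕ in atTop, c * x ^ n ≤ f n)
    (hup : ∀ᶠ n : ℕ in atTop, f n ≤ C * (n : ℝ) ^ p * x ^ n) :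
    Tendsto (fun n : ℕ => Real.log (f n) / n) atTop (nhds (Real.log x)) := by
  have hlog : Tendsto (fun n : ℕ => Real.log (n : ℝ) / n) atTop (nhds 0) :=
    Real.isLittleO_log_id_atTop.tendsto_div_nhds_zero.comp tendsto_natCast_atTop_atTop
  have hl : Tendsto (fun n : ℕ => Real.log c / n + Real.log x) atTop (nhds (Real.log x)) := by
    simpa using (tendsto_const_div_atTop_nhds_zero_nat (Real.log c)).add_const (Real.log x)
  have hu : Tendsto (fun n : ℕ => Real.log C / n + p * (Real.log (n : ℝ) / n) + Real.log x)
      atTop (nhds (Real.log x)) := by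
    simpa using ((tendsto_const_div_atTop_nhds_zero_nat (Real.log C)).add
      (hlog.const_mul (p : ℝ))).add_const (Real.log x)
  refine tendsto_of_tendsto_of_tendsto_of_le_of_le' hl hu ?_ ?_
  · filter_upwards [hlow, eventually_gt_atTop 0] with n h hn
    have hn' : (0 : ℝ) < n := by exact_mod_cast hn
    have h1 := Real.log_le_log (by positivity) h
    rw [Real.log_mul (by positivity) (by positivity), Real.log_pow] at h1
    rw [le_div_iff₀ hn']
    field_simp
    linarith
  · filter_upwards [hlow, hup, eventually_gt_atTop 0] with n h0 h hn
    have hn' : (0 : ℝ) < n := by exact_mod_cast hn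
    have h1 := Real.log_le_log (lt_of_lt_of_le (by positivity) h0) h
    rw [Real.log_mul (by positivity) (by positivity), Real.log_mul (by positivity) (by positivity),
      Real.log_pow, Real.log_pow] at h1
    rw [div_le_iff₀ hn']
    field_simp
    linarith

/-- A single minor bounds the Gram determinant of two vectors from below. -/
lemma minor_sq_le_two_mul_gram {ι : Type*} (s : Finset ι) (u v : ι → ℝ) {i j : ι} (hi : i ∈ s)
    (hj : j ∈ s) :
    (u i * v j - u j * v i) ^ 2 ≤
      2 * ((∑ k ∈ s, u k ^ 2) * (∑ k ∈ s, v k ^ 2) - (∑ k ∈ s, u k * v k) ^ 2) := by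
  have key : ∑ a ∈ s, ∑ b ∈ s, (u a * v b - u b * v a) ^ 2 =
      2 * ((∑ k ∈ s, u k ^ 2) * (∑ k ∈ s, v k ^ 2) - (∑ k ∈ s, u k * v k) ^ 2) := by
    have h : ∀ a b, (u a * v b - u b * v a) ^ 2 =
        u a ^ 2 * v b ^ 2 + v a ^ 2 * u b ^ 2 - 2 * ((u a * v a) * (u b * v b)) := by
      intro a b; ring
    simp_rw [h, Finset.sum_sub_distrib, Finset.sum_add_distrib, ← Finset.mul_sum,
      ← Finset.sum_mul]
    ring
  rw [← key]
  refine le_trans ?_ (Finset.single_le_sum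
    (f := fun a => ∑ b ∈ s, (u a * v b - u b * v a) ^ 2)
    (fun a _ => Finset.sum_nonneg fun b _ => sq_nonneg _) hi)
  exact Finset.single_le_sum (f := fun b => (u i * v b - u b * v i) ^ 2)
    (fun b _ => sq_nonneg _) hj

lemma one_add_sum_sq_le {e : ℕ → ℝ} {γ K : ℝ} (hγ : 1 < |γ|)
    (he : ∀ k : ℕ, 1 ≤ k → |e k| ≤ K * k * |γ| ^ k) {n : ℕ} (hn : 1 ≤ n) :
    1 + ∑ k ∈ Finset.Icc 1 n, e k ^ 2 ≤ (1 + K ^ 2) * (n : ℝ) ^ 3 * (γ ^ 2) ^ n := by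
  have hK : 0 ≤ K := by
    have h := (abs_nonneg _).trans (he 1 le_rfl)
    simp only [Nat.cast_one, mul_one, pow_one] at h
    exact nonneg_of_mul_nonneg_left h (by linarith)
  have hγn : (γ ^ 2) ^ n = (|γ| ^ n) ^ 2 := by rw [← sq_abs, ← pow_mul, ← pow_mul, mul_comm]
  have hb : ∀ k ∈ Finset.Icc 1 n, e k ^ 2 ≤ (K * n * |γ| ^ n) ^ 2 := by
    intro k hk
    obtain ⟨h1, h2⟩ := Finset.mem_Icc.mp hk
    rw [← sq_abs]
    have : |γ| ^ k ≤ |γ| ^ n := pow_le_pow_right₀ hγ.le h2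
    have : (k : ℝ) ≤ n := by exact_mod_cast h2
    refine pow_le_pow_left₀ (abs_nonneg _) ((he k h1).trans ?_) 2
    gcongr
  have hs := Finset.sum_le_card_nsmul _ _ _ hb
  rw [Nat.card_Icc, nsmul_eq_mul, Nat.add_sub_cancel] at hs
  have hone : (1 : ℝ) ≤ (n : ℝ) ^ 3 * (|γ| ^ n) ^ 2 :=
    one_le_mul_of_one_le_of_one_le (one_le_pow₀ (by exact_mod_cast hn))
      (one_le_pow₀ (one_le_pow₀ hγ.le))
  rw [hγn]
  nlinarith

lemma det_one_add_transpose_mul_self_two (u v : ℕ → ℝ) (n : ℕ) (D : Matrix (Fin n) (Fin 2) ℝ)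
    (hD : D = Matrix.of fun k i => ![u (k.val + 1), v (k.val + 1)] i) :
    ((1 : Matrix (Fin 2) (Fin 2) ℝ) + Dᵀ * D).det =
      (1 + ∑ k ∈ Finset.Icc 1 n, u k ^ 2) * (1 + ∑ k ∈ Finset.Icc 1 n, v k ^ 2) -
        (∑ k ∈ Finset.Icc 1 n, u k * v k) ^ 2 := by
  have hsum : ∀ f : ℕ → ℝ, ∑ k ∈ Finset.Icc 1 n, f k = ∑ k : Fin n, f (k.val + 1) := by
    intro f
    rw [Fin.sum_univ_eq_sum_range (fun k => f (k + 1)) n, Finset.range_eq_Ico,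
      Finset.sum_Ico_add' f 0 n 1]
    rfl
  subst hD
  simp only [hsum, Matrix.det_fin_two, Matrix.add_apply, Matrix.mul_apply, Matrix.transpose_apply,
    Matrix.of_apply, Matrix.one_apply, Matrix.cons_val_zero, Matrix.cons_val_one, ← sq,
    mul_comm (v _) (u _)]
  simp
  ring

/-- Case B (repeated root) MMSE convergence rate:
`−(1/(2n)) log((1 + ∑_{k=1}^n d₂ₖ²)/det(I₂ + DₙᵀDₙ)) → log|γ|`. -/
theorem stmt10 (γ ℓ ℓ' : ℝ) (hγ : 1 < |γ|) (hl : ℓ ≠ 0) :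
    let d₁ : ℕ → ℝ := fun k =>
      ((2 - (k : ℝ)) * ℓ + ℓ' * γ⁻¹) * γ ^ ((k : ℤ) - 1)
    let d₂ : ℕ → ℝ := fun k =>
      (((k : ℝ) - 1) * ℓ - ℓ' * γ⁻¹) * γ ^ ((k : ℤ) - 2)
    let Dm : (n : ℕ) → Matrix (Fin n) (Fin 2) ℝ := fun n =>
      Matrix.of fun k i => ![d₁ (k.val + 1), d₂ (k.val + 1)] i
    Tendsto (fun n : ℕ =>
        -(1 / (2 * (n : ℝ))) *
          Real.log ((1 + ∑ k ∈ Finset.Icc 1 n, (d₂ k) ^ 2) /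
            ((1 : Matrix (Fin 2) (Fin 2) ℝ) + (Dm n)ᵀ * Dm n).det))
      atTop (nhds (Real.log |γ|)) := by
  intro d₁ d₂ Dm
  have hγ0 : γ ≠ 0 := by
    rintro rfl
    norm_num at hγ
  set b := ℓ' * γ⁻¹
  have hd₁ : ∀ k, d₁ k = ((2 - (k : ℝ)) * ℓ + b) * (γ ^ k * γ⁻¹) := by
    intro k
    simp only [d₁, b, zpow_sub₀ hγ0, zpow_natCast, zpow_one, div_eq_mul_inv]
  have hd₂ : ∀ k, d₂ k = (((k : ℝ) - 1) * ℓ - b) * (γ ^ k * (γ ^ 2)⁻¹) := by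
    intro k
    simp only [d₂, zpow_sub₀ hγ0, zpow_natCast, div_eq_mul_inv]
    norm_cast
  have hinv : |γ|⁻¹ ≤ 1 := inv_le_one_of_one_le₀ hγ.le
  have hinv2 : (|γ| ^ 2)⁻¹ ≤ 1 := inv_le_one_of_one_le₀ (one_le_pow₀ hγ.le)
  have habs : ∀ {k : ℕ} {t s : ℝ}, 1 ≤ k → |t| ≤ k → |s| = |b| → ∀ {y : ℝ}, |y| ≤ 1 →
      |(t * ℓ + s) * (γ ^ k * y)| ≤ (|ℓ| + |b|) * k * |γ| ^ k := by
    intro k t s hk ht hs y hy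
    have hk' : (1 : ℝ) ≤ k := by exact_mod_cast hk
    have h1 : |t * ℓ + s| ≤ (|ℓ| + |b|) * k := by
      have h2 := abs_add_le (t * ℓ) s
      rw [abs_mul, hs] at h2
      nlinarith [abs_nonneg ℓ, abs_nonneg b]
    have h3 : |γ| ^ k * |y| ≤ |γ| ^ k := mul_le_of_le_one_right (by positivity) hy
    rw [abs_mul, abs_mul, abs_pow]
    gcongr
  have hb₁ : ∀ k : ℕ, 1 ≤ k → |d₁ k| ≤ (|ℓ| + |b|) * k * |γ| ^ k := by
    intro k hk
    have hk' : (1 : ℝ) ≤ k := by exact_mod_cast hk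
    rw [hd₁]
    exact habs hk (abs_le.mpr ⟨by linarith, by linarith⟩) rfl (by rwa [abs_inv])
  have hb₂ : ∀ k : ℕ, 1 ≤ k → |d₂ k| ≤ (|ℓ| + |b|) * k * |γ| ^ k := by
    intro k hk
    have hk' : (1 : ℝ) ≤ k := by exact_mod_cast hk
    rw [hd₂, sub_eq_add_neg _ b]
    exact habs hk (abs_le.mpr ⟨by linarith, by linarith⟩) (abs_neg b)
      (by rwa [abs_inv, abs_pow])
  have hdet : ∀ n, ((1 : Matrix (Fin 2) (Fin 2) ℝ) + (Dm n)ᵀ * Dm n).det =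
      (1 + ∑ k ∈ Finset.Icc 1 n, d₁ k ^ 2) * (1 + ∑ k ∈ Finset.Icc 1 n, d₂ k ^ 2) -
        (∑ k ∈ Finset.Icc 1 n, d₁ k * d₂ k) ^ 2 :=
    fun n => det_one_add_transpose_mul_self_two d₁ d₂ n (Dm n) rfl
  set N : ℕ → ℝ := fun n => 1 + ∑ k ∈ Finset.Icc 1 n, d₂ k ^ 2 with hN
  set M : ℕ → ℝ := fun n => 1 + ∑ k ∈ Finset.Icc 1 n, d₁ k ^ 2 with hM
  set E : ℕ → ℝ := fun n => M n * N n - (∑ k ∈ Finset.Icc 1 n, d₁ k * d₂ k) ^ 2 with hE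
  have hNpos : ∀ n, 0 < N n := fun n => by positivity
  have hKpos : 0 < 1 + (|ℓ| + |b|) ^ 2 := by positivity
  have hElow : ∀ᶠ n : ℕ in atTop, ℓ ^ 4 * (γ ^ 8)⁻¹ / 2 * (γ ^ 4) ^ n ≤ E n := by
    filter_upwards [eventually_ge_atTop 2] with n hn
    obtain ⟨m, rfl⟩ := Nat.exists_eq_add_of_le' (show 1 ≤ n by omega)
    have h := minor_sq_le_two_mul_gram (Finset.Icc 1 (m + 1)) d₁ d₂ (i := m) (j := m + 1)
      (by simp; omega) (by simp)
    have hminor : (d₁ m * d₂ (m + 1) - d₁ (m + 1) * d₂ m) ^ 2 =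
        ℓ ^ 4 * (γ ^ 8)⁻¹ * (γ ^ 4) ^ (m + 1) := by
      rw [hd₁, hd₁, hd₂, hd₂]
      push_cast
      field_simp
      ring
    rw [hminor] at h
    have h1 : 0 ≤ ∑ k ∈ Finset.Icc 1 (m + 1), d₁ k ^ 2 := by positivity
    have h2 : 0 ≤ ∑ k ∈ Finset.Icc 1 (m + 1), d₂ k ^ 2 := by positivity
    simp only [hE, hM, hN]
    linarith
  have hEup : ∀ᶠ n : ℕ in atTop,
      E n ≤ (1 + (|ℓ| + |b|) ^ 2) ^ 2 * (n : ℝ) ^ 6 * (γ ^ 4) ^ n := by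
    filter_upwards [eventually_ge_atTop 1] with n hn
    calc E n ≤ M n * N n := sub_le_self _ (sq_nonneg _)
      _ ≤ _ := mul_le_mul (one_add_sum_sq_le hγ hb₁ hn) (one_add_sum_sq_le hγ hb₂ hn)
        (hNpos n).le (by positivity)
      _ = _ := by ring
  have hNlow : ∀ᶠ n : ℕ in atTop, (γ ^ 4)⁻¹ * (γ ^ 2) ^ n ≤ N n := by
    have hlim : Tendsto (fun n : ℕ => (n : ℝ) * |ℓ|) atTop atTop :=
      tendsto_natCast_atTop_atTop.atTop_mul_const (abs_pos.mpr hl)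
    filter_upwards [hlim.eventually_ge_atTop (1 + |ℓ| + |b|), eventually_ge_atTop 1] with n h hn
    have hc : 1 ≤ |((n : ℝ) - 1) * ℓ - b| := by
      have h1 := abs_sub_abs_le_abs_sub ((n : ℝ) * ℓ) (ℓ + b)
      rw [abs_mul, Nat.abs_cast] at h1
      have h2 := abs_add_le ℓ b
      rw [show ((n : ℝ) - 1) * ℓ - b = n * ℓ - (ℓ + b) by ring]
      linarith
    have hc2 : 1 ≤ (((n : ℝ) - 1) * ℓ - b) ^ 2 := (one_le_sq_iff_one_le_abs _).mpr hc
    have hs : d₂ n ^ 2 ≤ ∑ k ∈ Finset.Icc 1 n, d₂ k ^ 2 :=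
      Finset.single_le_sum (f := fun k => d₂ k ^ 2) (fun k _ => sq_nonneg _)
        (Finset.mem_Icc.mpr ⟨hn, le_rfl⟩)
    have hd : d₂ n ^ 2 = (((n : ℝ) - 1) * ℓ - b) ^ 2 * ((γ ^ 4)⁻¹ * (γ ^ 2) ^ n) := by
      rw [hd₂]
      ring
    have h3 : (γ ^ 4)⁻¹ * (γ ^ 2) ^ n ≤ d₂ n ^ 2 := by
      rw [hd]
      exact le_mul_of_one_le_left (by positivity) hc2
    simp only [hN]
    linarith
  have hNup : ∀ᶠ n : ℕ in atTop, N n ≤ (1 + (|ℓ| + |b|) ^ 2) * (n : ℝ) ^ 3 * (γ ^ 2) ^ n := by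
    filter_upwards [eventually_ge_atTop 1] with n hn
    exact one_add_sum_sq_le hγ hb₂ hn
  have hEc : 0 < ℓ ^ 4 * (γ ^ 8)⁻¹ / 2 := by positivity
  have hγ4 : 0 < γ ^ 4 := by positivity
  have hlimE := tendsto_log_div_of_le_of_le 6 hγ4 hEc (by positivity) hElow hEup
  have hlimN := tendsto_log_div_of_le_of_le 3 (by positivity) (by positivity) hKpos hNlow hNup
  have hlim := (hlimE.sub hlimN).const_mul (1 / 2)
  have hval : 1 / 2 * (Real.log (γ ^ 4) - Real.log (γ ^ 2)) = Real.log |γ| := by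
    rw [Real.log_pow, Real.log_pow, Real.log_abs]
    push_cast
    ring
  rw [hval] at hlim
  refine hlim.congr' ?_
  filter_upwards [hElow] with n hn
  have hEpos : 0 < E n := lt_of_lt_of_le (by positivity) hn
  rw [hdet, Real.log_div (hNpos n).ne' hEpos.ne']
  ring
end

section
/- Define g(x, y) = L(x⁻¹)²/(x² − 1) + L(y⁻¹)²/(y² − 1) − 2L(x⁻¹)L(y⁻¹)/(xy − 1) and f(x, y) = ((x² − 1)(y² − 1)(xy − 1)² / ((x − y)² L(x⁻¹)² L(y⁻¹)²)) · g(x, y). Then the limit of f(x, γ) as x → γ with x ≠ γ exists and equals (γ² − 1)³ L′(γ⁻¹)²/(γ⁴ L(γ⁻¹)⁴) + 2(γ² − 1)² L′(γ⁻¹)/(γ L(γ⁻¹)³) + (γ⁴ − 1)/L(γ⁻¹)², where L′ denotes the derivative of L. -/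
open Filter

/-- Algebraic form of the cancellation: after factoring out `(x - y) ^ 2` only the slope
`(a - b) / (x - y)` remains. -/
lemma normalized_gap_eq {x y a b : ℝ} (hxy : x - y ≠ 0) (ha : a ≠ 0) (hb : b ≠ 0)
    (hx : x ^ 2 - 1 ≠ 0) (hy : y ^ 2 - 1 ≠ 0) (hz : x * y - 1 ≠ 0) :
    ((x ^ 2 - 1) * (y ^ 2 - 1) * (x * y - 1) ^ 2 / ((x - y) ^ 2 * a ^ 2 * b ^ 2)) *
        (a ^ 2 / (x ^ 2 - 1) + b ^ 2 / (y ^ 2 - 1) - 2 * a * b / (x * y - 1)) =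
      (x * y - 1) * (b ^ 2 * (x * y + 1) - 2 * b * ((a - b) / (x - y)) * (y ^ 2 - 1) * x
        + ((a - b) / (x - y)) ^ 2 * (x * y - 1) * (y ^ 2 - 1)) / (a ^ 2 * b ^ 2) := by
  field_simp
  ring

/-- The limit of the normalized gap for an arbitrary function differentiable at `y⁻¹`. -/
lemma tendsto_normalized_gap {L : ℝ → ℝ} {y : ℝ} (hL : DifferentiableAt ℝ L y⁻¹)
    (hLy : L y⁻¹ ≠ 0) (hy0 : y ≠ 0) (hy : y ^ 2 - 1 ≠ 0) :
    Tendsto (fun x => ((x ^ 2 - 1) * (y ^ 2 - 1) * (x * y - 1) ^ 2 /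
          ((x - y) ^ 2 * L x⁻¹ ^ 2 * L y⁻¹ ^ 2)) *
        (L x⁻¹ ^ 2 / (x ^ 2 - 1) + L y⁻¹ ^ 2 / (y ^ 2 - 1) - 2 * L x⁻¹ * L y⁻¹ / (x * y - 1)))
      (nhdsWithin y {y}ᶜ)
      (nhds ((y ^ 2 - 1) ^ 3 * (deriv L y⁻¹) ^ 2 / (y ^ 4 * L y⁻¹ ^ 4)
        + 2 * (y ^ 2 - 1) ^ 2 * deriv L y⁻¹ / (y * L y⁻¹ ^ 3)
        + (y ^ 4 - 1) / L y⁻¹ ^ 2)) := by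
  have hd : HasDerivAt (fun x => L x⁻¹) (deriv L y⁻¹ * -(y ^ 2)⁻¹) y :=
    hL.hasDerivAt.comp y (hasDerivAt_inv hy0)
  have hs : Tendsto (fun x => (L x⁻¹ - L y⁻¹) / (x - y)) (nhdsWithin y {y}ᶜ)
      (nhds (deriv L y⁻¹ * -(y ^ 2)⁻¹)) := by
    simpa only [slope_fun_def_field] using hasDerivAt_iff_tendsto_slope.mp hd
  have hc : Tendsto (fun x => L x⁻¹) (nhdsWithin y {y}ᶜ) (nhds (L y⁻¹)) :=
    hd.continuousAt.tendsto.mono_left nhdsWithin_le_nhds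
  have hi : Tendsto (fun x : ℝ => x) (nhdsWithin y {y}ᶜ) (nhds y) := nhdsWithin_le_nhds
  have hz : Tendsto (fun x => x * y - 1) (nhdsWithin y {y}ᶜ) (nhds (y * y - 1)) :=
    (hi.mul_const y).sub_const 1
  have hx : Tendsto (fun x => x ^ 2 - 1) (nhdsWithin y {y}ᶜ) (nhds (y ^ 2 - 1)) :=
    (hi.pow 2).sub_const 1
  have hlim := (hz.mul ((((hi.mul_const y).add_const 1).const_mul (L y⁻¹ ^ 2)
    |>.sub (((hs.const_mul (2 * L y⁻¹)).mul_const (y ^ 2 - 1)).mul hi)).add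
    (((hs.pow 2).mul hz).mul_const (y ^ 2 - 1)))).div ((hc.pow 2).mul_const (L y⁻¹ ^ 2))
    (mul_ne_zero (pow_ne_zero 2 hLy) (pow_ne_zero 2 hLy))
  refine (hlim.congr' ?_).trans (le_of_eq ?_)
  · filter_upwards [hc.eventually_ne hLy, hx.eventually_ne hy,
      hz.eventually_ne (by rwa [← pow_two]), self_mem_nhdsWithin] with x h1 h2 h3 h4
    exact (normalized_gap_eq (sub_ne_zero.mpr h4) h1 hLy h2 hy h3).symm
  · congr 1
    field_simp
    ring

lemma prod_one_add_mul_ne_zero {ι : Type*} [Fintype ι] {β : ι → ℝ} (hβ : ∀ k, |β k| < 1)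
    {x : ℝ} (hx : |x| ≤ 1) : ∏ k, (1 + β k * x) ≠ 0 := by
  refine Finset.prod_ne_zero_iff.mpr fun k _ => ne_of_gt ?_
  have h : |β k * x| < 1 := by
    rw [abs_mul]
    exact (mul_le_of_le_one_right (abs_nonneg _) hx).trans_lt (hβ k)
  linarith [(abs_lt.mp h).1]

/-- identity (42)/(46) of the paper. With
`g(x,γ) = L(x⁻¹)²/(x²−1) + L(γ⁻¹)²/(γ²−1) − 2L(x⁻¹)L(γ⁻¹)/(xγ−1)` and
`f(x,γ) = ((x²−1)(γ²−1)(xγ−1)²/((x−γ)²L(x⁻¹)²L(γ⁻¹)²))·g(x,γ)`, the limit of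
`f(x,γ)` as `x → γ`, `x ≠ γ`, equals
`(γ²−1)³L′(γ⁻¹)²/(γ⁴L(γ⁻¹)⁴) + 2(γ²−1)²L′(γ⁻¹)/(γL(γ⁻¹)³) + (γ⁴−1)/L(γ⁻¹)²`. -/
theorem stmt13 (p : ℕ) (hp : 1 ≤ p) (β : Fin p → ℝ) (hβ : ∀ k, |β k| < 1)
    (γ : ℝ) (hγ : 1 < |γ|) :
    let L : ℝ → ℝ := fun x => ∏ k, (1 + β k * x)
    let g : ℝ → ℝ := fun x =>
      L x⁻¹ ^ 2 / (x ^ 2 - 1) + L γ⁻¹ ^ 2 / (γ ^ 2 - 1)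
        - 2 * L x⁻¹ * L γ⁻¹ / (x * γ - 1)
    let f : ℝ → ℝ := fun x =>
      ((x ^ 2 - 1) * (γ ^ 2 - 1) * (x * γ - 1) ^ 2 /
          ((x - γ) ^ 2 * L x⁻¹ ^ 2 * L γ⁻¹ ^ 2)) * g x
    Tendsto f (nhdsWithin γ {γ}ᶜ)
      (nhds ((γ ^ 2 - 1) ^ 3 * (deriv L γ⁻¹) ^ 2 / (γ ^ 4 * L γ⁻¹ ^ 4)
        + 2 * (γ ^ 2 - 1) ^ 2 * deriv L γ⁻¹ / (γ * L γ⁻¹ ^ 3)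
        + (γ ^ 4 - 1) / L γ⁻¹ ^ 2)) := by
  intro L g f
  have hy : 0 < γ ^ 2 - 1 := sub_pos.mpr ((one_lt_sq_iff_one_lt_abs γ).mpr hγ)
  have hy0 : γ ≠ 0 := abs_pos.mp (one_pos.trans hγ)
  have hLγ : L γ⁻¹ ≠ 0 :=
    prod_one_add_mul_ne_zero hβ (by rw [abs_inv]; exact inv_le_one_of_one_le₀ hγ.le)
  have hL : DifferentiableAt ℝ L γ⁻¹ := by
    dsimp only [L]
    fun_prop
  exact tendsto_normalized_gap hL hLγ hy0 hy.ne'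
end
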